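/- arXiv:1001.0684 — 2 statements merged into one kernel-verified Lean document; each statement's English description precedes it below -/
import Mathlib

section
/- (Kaltofen; Cafure & Matera) Let q be a prime power, 𝔽_q the finite field with q elements, and let f ∈ 𝔽_q[x_0, x_1, …, x_n] be an absolutely irreducible polynomial of total degree d ≥ 2. For ξ = (ξ_0, ξ_1, …, ξ_{3n}) ∈ 𝔽_q^{3n+1}, define the sliced polynomial f|_ξ ∈ 𝔽_q[X,Y] by f|_ξ(X,Y) = f(ξ_0 + X, ξ_1 + ξ_{n+1}X + ξ_{2n+1}Y, …, ξ_n + ξ_{2n}X + ξ_{3n}Y). Then the number of slices ξ ∈ 𝔽_q^{3n+1} for which f|_ξ is not absolutely irreducible is at most (1/2)·(3d⁴ − 4d³ + 5d²)·q^{3n}. -/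
open MvPolynomial

/-- The sliced polynomial `f|_ξ(X,Y)`: substitute `x_0 ↦ ξ_0 + X` and
`x_i ↦ ξ_i + ξ_{n+i} X + ξ_{2n+i} Y` for `1 ≤ i ≤ n` into
`f ∈ 𝔽_q[x_0, …, x_n]`, yielding a bivariate polynomial in `X = X 0`, `Y = X 1`. -/
noncomputable def slicedPoly {K : Type*} [CommRing K] {n : ℕ}
    (f : MvPolynomial (Fin (n + 1)) K) (ξ : Fin (3 * n + 1) → K) :
    MvPolynomial (Fin 2) K :=
  aeval (fun i : Fin (n + 1) =>
    if i.val = 0 then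
      C (ξ ⟨0, by omega⟩) + X 0
    else
      C (ξ ⟨i.val, by have := i.isLt; omega⟩) +
        C (ξ ⟨n + i.val, by have := i.isLt; omega⟩) * X 0 +
        C (ξ ⟨2 * n + i.val, by have := i.isLt; omega⟩) * X 1) f

lemma MvPolynomial.exists_pderiv_ne_zero_of_irreducible {σ F : Type*} [Finite σ] [Field F]
    {p : ℕ} [Fact p.Prime] [CharP F p] [PerfectRing F p] {f : MvPolynomial σ F} (hf : Irreducible f) :
    ∃ i, pderiv i f ≠ 0 := by
  classical
  by_contra! H
  have hp : p ≠ 0 := (Fact.out : p.Prime).ne_zero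
  have hdvd : ∀ m ∈ f.support, ∀ i, p ∣ m i := by
    intro m hm i
    by_cases hmi : m i = 0
    · simp [hmi]
    have h1 := congrArg (coeff (m - Finsupp.single i 1)) (H i)
    have hle : Finsupp.single i 1 ≤ m := by
      rw [Finsupp.single_le_iff]; omega
    rw [coeff_pderiv, tsub_add_cancel_of_le hle] at h1
    simp only [coeff_zero, mul_eq_zero] at h1
    rcases h1 with h1 | h1
    · exact absurd h1 (mem_support_iff.mp hm)
    · have h2 : ((m i : ℕ) : F) = 0 := by
        rw [← h1]
        norm_cast
        congr 1
        simp
        omega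
      exact (CharP.cast_eq_zero_iff F p _).mp h2
  choose! g hg using hdvd
  obtain ⟨φ, hφ⟩ : ∃ φ : MvPolynomial σ F, φ ^ p = f := by
    refine ⟨∑ m ∈ f.support, monomial (Finsupp.equivFunOnFinite.symm (g m))
      ((frobeniusEquiv F p).symm (coeff m f)), ?_⟩
    rw [sum_pow_char]
    conv_rhs => rw [f.as_sum]
    refine Finset.sum_congr rfl fun m hm => ?_
    rw [monomial_pow]
    rw [frobeniusEquiv_symm_pow_p, show p • Finsupp.equivFunOnFinite.symm (g m) = m from
      Finsupp.ext fun i => (hg m hm i).symm]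
  rw [← hφ] at hf
  exact not_irreducible_pow (Fact.out : p.Prime).one_lt.ne' hf

lemma Polynomial.irreducible_of_irreducible_map_of_isUnit_leadingCoeff {R S : Type*}
    [CommRing R] [IsDomain R] [CommRing S] [IsDomain S]
    (φ : R →+* S) {f : Polynomial R} (hu : IsUnit f.leadingCoeff)
    (h : Irreducible (f.map φ)) : Irreducible f := by
  obtain ⟨u, hu⟩ := hu
  have hm : (Polynomial.C (↑u⁻¹ : R) * f).Monic := by
    rw [Polynomial.Monic, Polynomial.leadingCoeff_mul, Polynomial.leadingCoeff_C, ← hu]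
    simp
  have hU : IsUnit (Polynomial.C (↑u⁻¹ : R)) := Polynomial.isUnit_C.mpr (u⁻¹).isUnit
  rw [← irreducible_isUnit_mul hU]
  refine hm.irreducible_of_irreducible_map φ _ ?_
  rw [Polynomial.map_mul]
  exact (irreducible_isUnit_mul (hU.map (Polynomial.mapRingHom φ))).mpr h

lemma Polynomial.irreducible_map_fraction_of_isUnit_leadingCoeff {R : Type*}
    (L : Type*) [CommRing R] [IsDomain R] [Field L] [Algebra R L]
    [IsFractionRing R L] [IsIntegrallyClosed R] {f : Polynomial R} (hu : IsUnit f.leadingCoeff)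
    (h : Irreducible f) : Irreducible (f.map (algebraMap R L)) := by
  obtain ⟨u, hu⟩ := hu
  have hm : (Polynomial.C (↑u⁻¹ : R) * f).Monic := by
    rw [Polynomial.Monic, Polynomial.leadingCoeff_mul, Polynomial.leadingCoeff_C, ← hu]
    simp
  have hU : IsUnit (Polynomial.C (↑u⁻¹ : R)) := Polynomial.isUnit_C.mpr (u⁻¹).isUnit
  rw [← irreducible_isUnit_mul hU, hm.irreducible_iff_irreducible_map_fraction_map (K := L),
    Polynomial.map_mul] at h
  exact (irreducible_isUnit_mul (hU.map (Polynomial.mapRingHom (algebraMap R L)))).mp h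

lemma Polynomial.resultant_ne_zero_of_irreducible {R : Type*} [CommRing R] [IsDomain R]
    [IsIntegrallyClosed R] {p q : Polynomial R}
    (hp : Irreducible p) (hu : IsUnit p.leadingCoeff) (hq : q ≠ 0) (hdeg : q.natDegree < p.natDegree)
    {m n : ℕ} (hm : p.natDegree = m) (hn : q.natDegree ≤ n) : Polynomial.resultant p q m n ≠ 0 := by
  let L := FractionRing R
  subst hm
  obtain ⟨k, rfl⟩ := Nat.exists_eq_add_of_le hn
  rw [Polynomial.resultant_add_right_deg _ _ _ _ _ le_rfl]
  refine mul_ne_zero (pow_ne_zero _ (by simpa using hp.ne_zero)) ?_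
  intro h0
  have hinj := IsFractionRing.injective R L
  have h1 := congrArg (algebraMap R L) h0
  rw [← Polynomial.resultant_map_map, map_zero,
    ← Polynomial.natDegree_map_eq_of_injective hinj p,
    ← Polynomial.natDegree_map_eq_of_injective hinj q, Polynomial.resultant_eq_zero_iff] at h1
  refine h1.2 ?_
  rw [(Polynomial.irreducible_map_fraction_of_isUnit_leadingCoeff L hu hp).coprime_iff_not_dvd]
  intro hd
  have := Polynomial.natDegree_le_of_dvd hd ((Polynomial.map_ne_zero_iff hinj).mpr hq)
  rw [Polynomial.natDegree_map_eq_of_injective hinj,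
    Polynomial.natDegree_map_eq_of_injective hinj] at this
  omega

/-- A subadditive degree-like function on an algebra, for which constants have degree zero. -/
structure DegreeBound (F R : Type*) [CommRing F] [CommRing R] [Algebra F R] where
  /-- The degree of an element. -/
  deg : R → ℕ
  deg_algebraMap (a : F) : deg (algebraMap F R a) = 0
  deg_add_le (x y : R) : deg (x + y) ≤ max (deg x) (deg y)
  deg_mul_le (x y : R) : deg (x * y) ≤ deg x + deg y

namespace DegreeBound

variable {F R : Type*} [CommRing F] [CommRing R] [Algebra F R] (D : DegreeBound F R)

lemma deg_zero : D.deg 0 = 0 := by simpa using D.deg_algebraMap 0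

lemma deg_one : D.deg 1 = 0 := by simpa using D.deg_algebraMap 1

lemma deg_sum_le {ι : Type*} (s : Finset ι) (x : ι → R) {e : ℕ} (h : ∀ i ∈ s, D.deg (x i) ≤ e) :
    D.deg (∑ i ∈ s, x i) ≤ e := by
  classical
  induction s using Finset.induction_on with
  | empty => simp [D.deg_zero]
  | insert i s his ih =>
    rw [Finset.sum_insert his]
    exact (D.deg_add_le _ _).trans (max_le (h i (by simp))
      (ih fun j hj => h j (Finset.mem_insert_of_mem hj)))

lemma deg_prod_le {ι : Type*} (s : Finset ι) (x : ι → R) :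
    D.deg (∏ i ∈ s, x i) ≤ ∑ i ∈ s, D.deg (x i) := by
  classical
  induction s using Finset.induction_on with
  | empty => simp [D.deg_one]
  | insert i s his ih =>
    rw [Finset.prod_insert his, Finset.sum_insert his]
    exact (D.deg_mul_le _ _).trans (by gcongr)

lemma deg_pow_le (x : R) (k : ℕ) : D.deg (x ^ k) ≤ k * D.deg x := by
  simpa using D.deg_prod_le (Finset.range k) fun _ => x

lemma deg_aeval_le {σ : Type*} (x : σ → R) (hx : ∀ i, D.deg (x i) ≤ 1) (f : MvPolynomial σ F) :
    D.deg (aeval x f) ≤ f.totalDegree := by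
  rw [aeval_def, eval₂_eq]
  refine D.deg_sum_le _ _ fun m hm => (D.deg_mul_le _ _).trans ?_
  rw [D.deg_algebraMap, zero_add]
  refine (D.deg_prod_le _ _).trans (le_trans ?_ (le_totalDegree hm))
  exact Finset.sum_le_sum fun i _ => (D.deg_pow_le _ _).trans (by nlinarith [hx i])

lemma deg_det_le {ι : Type*} [Fintype ι] [DecidableEq ι] (M : Matrix ι ι R) (e : ι → ℕ)
    (h : ∀ i j, D.deg (M i j) ≤ e j) : D.deg M.det ≤ ∑ j, e j := by
  rw [Matrix.det_apply']
  refine D.deg_sum_le _ _ fun σ _ => (D.deg_mul_le _ _).trans ?_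
  have : D.deg ((Equiv.Perm.sign σ : ℤ) : R) = 0 := by
    simpa using D.deg_algebraMap ((Equiv.Perm.sign σ : ℤ) : F)
  rw [this, zero_add]
  exact (D.deg_prod_le _ _).trans (Finset.sum_le_sum fun i _ => h _ _)

lemma deg_resultant_le {p q : Polynomial R} {a b : ℕ} (m n : ℕ) (hp : ∀ k, D.deg (p.coeff k) ≤ a)
    (hq : ∀ k, D.deg (q.coeff k) ≤ b) : D.deg (Polynomial.resultant p q m n) ≤ m * b + n * a := by
  refine (D.deg_det_le _ (Fin.addCases (fun _ => b) fun _ => a) fun i j => ?_).trans ?_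
  · induction j using Fin.addCases with
    | left j =>
      simp only [Polynomial.sylvester, Matrix.of_apply, Fin.addCases_left]
      split_ifs
      · exact hq _
      · simp [D.deg_zero]
    | right j =>
      simp only [Polynomial.sylvester, Matrix.of_apply, Fin.addCases_right]
      split_ifs
      · exact hp _
      · simp [D.deg_zero]
  · simp [Fin.sum_univ_add]

/-- The maximal degree of a coefficient. -/
noncomputable def coeffs : DegreeBound F (Polynomial R) where
  deg p := p.support.sup fun k => D.deg (p.coeff k)
  deg_algebraMap a := by
    simp only [Polynomial.algebraMap_apply, ← Nat.le_zero, Finset.sup_le_iff]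
    intro k _
    rw [Polynomial.coeff_C]
    split_ifs
    · rw [D.deg_algebraMap]
    · rw [D.deg_zero]
  deg_add_le p q := by
    have hle (p : Polynomial R) (k : ℕ) :
        D.deg (p.coeff k) ≤ p.support.sup fun k => D.deg (p.coeff k) := by
      by_cases hk : k ∈ p.support
      · exact Finset.le_sup (f := fun k => D.deg (p.coeff k)) hk
      · rw [Polynomial.notMem_support_iff.mp hk, D.deg_zero]; exact Nat.zero_le _
    refine Finset.sup_le fun k _ => ?_
    rw [Polynomial.coeff_add]
    exact (D.deg_add_le _ _).trans (max_le_max (hle p k) (hle q k))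
  deg_mul_le p q := by
    have hle (p : Polynomial R) (k : ℕ) :
        D.deg (p.coeff k) ≤ p.support.sup fun k => D.deg (p.coeff k) := by
      by_cases hk : k ∈ p.support
      · exact Finset.le_sup (f := fun k => D.deg (p.coeff k)) hk
      · rw [Polynomial.notMem_support_iff.mp hk, D.deg_zero]; exact Nat.zero_le _
    refine Finset.sup_le fun k _ => ?_
    rw [Polynomial.coeff_mul]
    exact D.deg_sum_le _ _ fun x _ => (D.deg_mul_le _ _).trans (add_le_add (hle p _) (hle q _))

lemma deg_coeff_le (p : Polynomial R) (k : ℕ) : D.deg (p.coeff k) ≤ D.coeffs.deg p := by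
  by_cases hk : k ∈ p.support
  · exact Finset.le_sup (f := fun k => D.deg (p.coeff k)) hk
  · rw [Polynomial.notMem_support_iff.mp hk, D.deg_zero]; exact Nat.zero_le _

lemma deg_coeffs_le (p : Polynomial R) (e : ℕ) (h : ∀ k, D.deg (p.coeff k) ≤ e) :
    D.coeffs.deg p ≤ e :=
  Finset.sup_le fun k _ => h k

end DegreeBound

/-- The total degree as a degree bound. -/
noncomputable def totalDegreeBound (F σ : Type*) [CommRing F] :
    DegreeBound F (MvPolynomial σ F) where
  deg := totalDegree
  deg_algebraMap := totalDegree_C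
  deg_add_le := totalDegree_add
  deg_mul_le := totalDegree_mul

/-- The degree of a polynomial as a degree bound. -/
noncomputable def natDegreeBound (F R : Type*) [CommRing F] [CommRing R] [Algebra F R] :
    DegreeBound F (Polynomial R) where
  deg := Polynomial.natDegree
  deg_algebraMap _ := Polynomial.natDegree_C _
  deg_add_le := Polynomial.natDegree_add_le
  deg_mul_le _ _ := Polynomial.natDegree_mul_le

/-- The restriction of `f` to the line `b + c X`. -/
noncomputable def lineEval {F R σ : Type*} [CommRing F] [CommRing R] [Algebra F R] (b c : σ → R) :
    MvPolynomial σ F →ₐ[F] Polynomial R :=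
  aeval fun i => Polynomial.C (b i) + Polynomial.C (c i) * Polynomial.X

section lineEval

variable {F R S σ : Type*} [CommRing F] [CommRing R] [Algebra F R] [CommRing S] [Algebra F S]

lemma lineEval_map (φ : R →ₐ[F] S) (b c : σ → R) (f : MvPolynomial σ F) :
    (lineEval b c f).map (φ : R →+* S) = lineEval (φ ∘ b) (φ ∘ c) f := by
  have : (Polynomial.mapAlgHom φ).comp (lineEval b c) = lineEval (F := F) (φ ∘ b) (φ ∘ c) := by
    ext i : 1
    simp [lineEval]
  exact DFunLike.congr_fun this f

lemma natDegree_lineEval_le (b c : σ → R) (f : MvPolynomial σ F) :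
    (lineEval b c f).natDegree ≤ f.totalDegree :=
  (natDegreeBound F R).deg_aeval_le _ (fun i => by
    change Polynomial.natDegree _ ≤ 1
    compute_degree) f

lemma coeff_lineEval (b c : σ → R) (f : MvPolynomial σ F) {d : ℕ} (hd : f.totalDegree ≤ d) :
    (lineEval b c f).coeff d = aeval c (homogeneousComponent d f) := by
  classical
  have key (m : σ →₀ ℕ) (hm : m.degree ≤ d) :
      (∏ i ∈ m.support, (Polynomial.C (b i) + Polynomial.C (c i) * Polynomial.X) ^ m i).coeff d =
        if m.degree = d then ∏ i ∈ m.support, c i ^ m i else 0 := by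
    have hdeg (i : σ) : (Polynomial.C (b i) + Polynomial.C (c i) * Polynomial.X).natDegree ≤ 1 := by
      compute_degree
    have hpow (i : σ) : ((Polynomial.C (b i) + Polynomial.C (c i) * Polynomial.X) ^ m i).natDegree
        ≤ m i := (Polynomial.natDegree_pow_le_of_le _ (hdeg i)).trans (by simp)
    split_ifs with h
    · rw [← h, Finsupp.degree_apply]
      induction m.support using Finset.induction_on with
      | empty => simp
      | insert i s his ih =>
        rw [Finset.prod_insert his, Finset.sum_insert his, Finset.prod_insert his,
          Polynomial.coeff_mul_add_eq_of_natDegree_le (hpow i)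
            ((Polynomial.natDegree_prod_le _ _).trans (Finset.sum_le_sum fun i _ => hpow i)), ih]
        have := Polynomial.coeff_pow_of_natDegree_le (m := m i) (hdeg i)
        rw [mul_one] at this
        rw [this]
        simp
    · refine Polynomial.coeff_eq_zero_of_natDegree_lt (lt_of_le_of_lt ?_ (lt_of_le_of_ne hm h))
      exact (Polynomial.natDegree_prod_le _ _).trans (Finset.sum_le_sum fun i _ => hpow i)
  rw [homogeneousComponent_apply, map_sum, lineEval, aeval_def, eval₂_eq, Polynomial.finsetSum_coeff,
    Finset.sum_filter]
  refine Finset.sum_congr rfl fun m hm => ?_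
  rw [Polynomial.algebraMap_apply, Polynomial.coeff_C_mul, key m ((le_totalDegree hm).trans hd)]
  split_ifs
  · rw [aeval_monomial]; rfl
  · simp

end lineEval

lemma DegreeBound.deg_coeff_lineEval_le {F R σ : Type*} [CommRing F] [CommRing R] [Algebra F R]
    (D : DegreeBound F R) {b c : σ → R} (hb : ∀ i, D.deg (b i) ≤ 1) (hc : ∀ i, D.deg (c i) ≤ 1)
    (f : MvPolynomial σ F) (k : ℕ) : D.deg ((lineEval b c f).coeff k) ≤ f.totalDegree := by
  refine (D.deg_coeff_le _ k).trans
    (D.coeffs.deg_aeval_le _ (fun i => D.deg_coeffs_le _ _ fun k => ?_) f)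
  simp only [Polynomial.coeff_add, Polynomial.coeff_C, Polynomial.coeff_C_mul, Polynomial.coeff_X]
  refine (D.deg_add_le _ _).trans (max_le ?_ ((D.deg_mul_le _ _).trans ?_))
  · split_ifs
    · exact hb i
    · simp [D.deg_zero]
  · split_ifs
    · simpa [D.deg_one] using hc i
    · simpa [D.deg_zero] using hc i

section shear

variable {F : Type*} [Field F] {n : ℕ}

/-- The restriction of `f` to the generic line of direction `(1, w)`, with origin `v`. -/
noncomputable def shear (v : Fin (n + 1) → F) (w : Fin n → F) :
    MvPolynomial (Fin (n + 1)) F →ₐ[F] Polynomial (MvPolynomial (Fin n) F) :=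
  lineEval (fun i => C (v i) + (Fin.cons 0 X : Fin (n + 1) → MvPolynomial (Fin n) F) i)
    (fun i => C ((Fin.cons 1 w : Fin (n + 1) → F) i))

lemma shear_bijective (v : Fin (n + 1) → F) (w : Fin n → F) :
    Function.Bijective (shear v w) := by
  let Ψ : Polynomial (MvPolynomial (Fin n) F) →+* MvPolynomial (Fin (n + 1)) F :=
    Polynomial.eval₂RingHom
      ((aeval fun i : Fin n => X i.succ - C (v i.succ) - C (w i) * (X 0 - C (v 0)) :
        MvPolynomial (Fin n) F →ₐ[F] MvPolynomial (Fin (n + 1)) F) : _ →+* _) (X 0 - C (v 0))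
  have h1 : ((shear v w : MvPolynomial (Fin (n + 1)) F →+* _).comp Ψ) = RingHom.id _ := by
    refine Polynomial.ringHom_ext' (MvPolynomial.ringHom_ext (fun a => ?_) fun i => ?_) ?_
    · simp [Ψ, shear, lineEval, algebraMap_eq]
    · simp [Ψ, shear, lineEval, algebraMap_eq]
      ring
    · simp [Ψ, shear, lineEval, algebraMap_eq]
  have h2 : (Ψ.comp (shear v w : MvPolynomial (Fin (n + 1)) F →+* _)) = RingHom.id _ := by
    refine MvPolynomial.ringHom_ext (fun a => ?_) fun i => ?_
    · simp [Ψ, shear, lineEval, algebraMap_eq]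
    · refine Fin.cases ?_ (fun i => ?_) i
      · simp [Ψ, shear, lineEval, algebraMap_eq]
      · simp [Ψ, shear, lineEval, algebraMap_eq]
        ring
  exact Function.bijective_iff_has_inverse.mpr ⟨Ψ, fun x => DFunLike.congr_fun h2 x,
    fun x => DFunLike.congr_fun h1 x⟩

lemma irreducible_shear (v : Fin (n + 1) → F) (w : Fin n → F) {f : MvPolynomial (Fin (n + 1)) F}
    (hf : Irreducible f) : Irreducible (shear v w f) :=
  (MulEquiv.irreducible_iff (RingEquiv.ofBijective (shear v w) (shear_bijective v w))).mpr hf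

end shear

lemma derivative_lineEval {F R σ : Type*} [CommRing F] [CommRing R] [Algebra F R] [Fintype σ]
    (b c : σ → R) (f : MvPolynomial σ F) :
    Polynomial.derivative (lineEval b c f) =
      ∑ i, Polynomial.C (c i) * lineEval b c (pderiv i f) := by
  classical
  induction f using MvPolynomial.induction_on with
  | C a => simp [lineEval]
  | add p q hp hq => simp only [map_add, hp, hq, mul_add, Finset.sum_add_distrib]
  | mul_X p j hp =>
    simp only [map_mul, Polynomial.derivative_mul, hp, Derivation.leibniz, smul_eq_mul, map_add,
      mul_add, Finset.sum_add_distrib, pderiv_X, Finset.sum_mul]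
    rw [add_comm]
    congr 1
    · rw [Finset.sum_eq_single j]
      · simp only [lineEval, aeval_X, Pi.single_eq_same, map_one, mul_one,
          Polynomial.derivative_add, Polynomial.derivative_C, Polynomial.derivative_C_mul,
          Polynomial.derivative_X, zero_add]
        exact mul_comm _ _
      · intro i _ hi
        simp [hi.symm]
      · simp
    · refine Finset.sum_congr rfl fun i _ => by ring

open Polynomial in
lemma Polynomial.exists_eval_mem_pow {R : Type*} [CommRing R] (I : Ideal R) (p : Polynomial R)
    (a : R) (h : p.eval a ∈ I) (h' : ∃ u, u * p.derivative.eval a - 1 ∈ I) (m : ℕ) (hm : m ≠ 0) :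
    ∃ b, b - a ∈ I.radical ∧ p.eval b ∈ I ^ m := by
  let S := R ⧸ I ^ m
  have hnil : ∀ x ∈ I, IsNilpotent (Ideal.Quotient.mk (I ^ m) x) := fun x hx =>
    ⟨m, by rw [← map_pow, Ideal.Quotient.eq_zero_iff_mem]; exact Ideal.pow_mem_pow hx m⟩
  obtain ⟨u, hu⟩ := h'
  obtain ⟨r, ⟨hr1, hr2⟩, -⟩ := Polynomial.existsUnique_nilpotent_sub_and_aeval_eq_zero (P := p)
    (x := Ideal.Quotient.mk (I ^ m) a) (by
      rw [← Ideal.Quotient.algebraMap_eq, Polynomial.aeval_algebraMap_apply_eq_algebraMap_eval]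
      exact hnil _ h) (by
      rw [← Ideal.Quotient.algebraMap_eq, Polynomial.aeval_algebraMap_apply_eq_algebraMap_eval]
      have h1 := (hnil _ hu).isUnit_add_one
      rw [map_sub, map_one, sub_add_cancel, map_mul] at h1
      exact isUnit_of_mul_isUnit_right h1)
  obtain ⟨b, rfl⟩ := Ideal.Quotient.mk_surjective r
  refine ⟨b, ?_, ?_⟩
  · rw [← map_sub] at hr1
    obtain ⟨k, hk⟩ := hr1
    rw [← map_pow, Ideal.Quotient.eq_zero_iff_mem] at hk
    rw [← neg_mem_iff, neg_sub]
    exact ⟨k, Ideal.pow_le_self hm hk⟩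
  · rw [← Ideal.Quotient.algebraMap_eq, Polynomial.aeval_algebraMap_apply_eq_algebraMap_eval] at hr2
    exact Ideal.Quotient.eq_zero_iff_mem.mp hr2

lemma Matrix.exists_submatrix_det_ne_zero {R m n : Type*} [CommRing R] [IsDomain R] [Fintype m]
    [Fintype n] [DecidableEq n] (M : Matrix m n R) (h : ∀ x, M.mulVec x = 0 → x = 0) :
    ∃ e : n → m, (M.submatrix e id).det ≠ 0 := by
  classical
  let L := FractionRing R
  have hinj := IsFractionRing.injective R L
  let M' : Matrix m n L := M.map (algebraMap R L)
  have hli : LinearIndependent L M'.col := by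
    rw [← LinearIndependent.iff_fractionRing R L]
    rw [Fintype.linearIndependent_iff]
    intro g hg
    refine congrFun (h g ?_)
    ext i
    have := congrFun hg i
    apply hinj
    simpa [Matrix.mulVec, dotProduct, M', Algebra.smul_def, mul_comm] using this
  have hrank : M'.rank = Fintype.card n := by
    rw [Matrix.rank_eq_finrank_span_cols]
    exact finrank_span_eq_card hli
  have hspan : Submodule.span L (Set.range M'.row) = ⊤ := by
    apply Submodule.eq_top_of_finrank_eq
    rw [← Matrix.rank_eq_finrank_span_row, hrank]
    simp
  obtain ⟨κ, a, ha, hs, hl⟩ := exists_linearIndependent' L M'.row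
  rw [hspan] at hs
  let B := Module.Basis.mk hl hs.ge
  have : Finite κ := Finite.of_injective a ha
  have : Fintype κ := Fintype.ofFinite κ
  have hcard : Fintype.card n = Fintype.card κ := by
    have := Module.finrank_eq_card_basis B
    simpa using this
  let e := Fintype.equivOfCardEq hcard
  refine ⟨a ∘ e, fun h0 => ?_⟩
  have h1 : LinearIndependent L (M'.submatrix (a ∘ e) id).row := hl.comp e e.injective
  rw [Matrix.linearIndependent_rows_iff_isUnit, Matrix.isUnit_iff_isUnit_det] at h1
  apply h1.ne_zero
  have h2 := congrArg (algebraMap R L) h0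
  rw [RingHom.map_det, map_zero] at h2
  exact h2

lemma MvPolynomial.IsHomogeneous.eval_const_mul {R σ : Type*} [CommRing R] {p : MvPolynomial σ R}
    {d : ℕ} (hp : p.IsHomogeneous d) (r : R) (x : σ → R) :
    eval (fun i => r * x i) p = r ^ d * eval x p := by
  rw [eval_eq, eval_eq, Finset.mul_sum]
  refine Finset.sum_congr rfl fun m hm => ?_
  have hdeg : ∑ i ∈ m.support, m i = d := by
    have := hp (mem_support_iff.mp hm)
    simpa [Finsupp.weight_apply, Finsupp.sum] using this
  simp_rw [mul_pow, Finset.prod_mul_distrib, Finset.prod_pow_eq_pow_sum, hdeg]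
  ring

lemma MvPolynomial.homogeneousComponent_totalDegree_ne_zero {R σ : Type*} [CommRing R]
    {p : MvPolynomial σ R} (hp : p ≠ 0) : homogeneousComponent p.totalDegree p ≠ 0 := by
  obtain ⟨m, hm, hmd⟩ := Finset.exists_mem_eq_sup p.support (support_nonempty.mpr hp)
    fun s => s.degree
  intro h0
  have h1 := congrArg (coeff m) h0
  rw [coeff_homogeneousComponent, if_pos, coeff_zero] at h1
  · exact mem_support_iff.mp hm h1
  · rw [totalDegree, ← hmd]
    rfl

lemma exists_direction {F : Type*} [Field F] [Infinite F] {n : ℕ}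
    {f : MvPolynomial (Fin (n + 1)) F} (h0 : f ≠ 0) (hpd : ∃ i, pderiv i f ≠ 0) :
    ∃ w : Fin n → F, eval (Fin.cons 1 w) (homogeneousComponent f.totalDegree f) ≠ 0 ∧
      ∑ i, C ((Fin.cons 1 w : Fin (n + 1) → F) i) * pderiv i f ≠ 0 := by
  obtain ⟨i, hi⟩ := hpd
  obtain ⟨m, hm⟩ := ne_zero_iff.mp hi
  let q : MvPolynomial (Fin (n + 1)) F := ∑ j, C (coeff m (pderiv j f)) * X j
  have hq : q ≠ 0 := fun h => hm <| by
    have := congrArg (eval (Pi.single i 1)) h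
    simpa [q, Pi.single_apply] using this
  have hne : X 0 * homogeneousComponent f.totalDegree f * q ≠ 0 :=
    mul_ne_zero (mul_ne_zero (X_ne_zero 0) (homogeneousComponent_totalDegree_ne_zero h0)) hq
  obtain ⟨c, hc⟩ : ∃ c, eval c (X 0 * homogeneousComponent f.totalDegree f * q) ≠ 0 := by
    by_contra! H
    exact hne (MvPolynomial.funext fun x => by simpa using H x)
  rw [map_mul, map_mul, eval_X] at hc
  have hc0 : c 0 ≠ 0 := left_ne_zero_of_mul (left_ne_zero_of_mul hc)
  have hcons : (Fin.cons 1 (fun i => (c 0)⁻¹ * c i.succ) : Fin (n + 1) → F) =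
      fun i => (c 0)⁻¹ * c i := by
    ext i
    refine Fin.cases ?_ (fun i => ?_) i
    · simp [hc0]
    · simp
  refine ⟨fun i => (c 0)⁻¹ * c i.succ, ?_, ?_⟩
  · rw [hcons, (homogeneousComponent_isHomogeneous _ f).eval_const_mul]
    exact mul_ne_zero (pow_ne_zero _ (inv_ne_zero hc0))
      (right_ne_zero_of_mul (left_ne_zero_of_mul hc))
  · intro h
    have h1 := congrArg (coeff m) h
    rw [hcons] at h1
    simp only [coeff_sum, coeff_C_mul, coeff_zero, mul_assoc, ← Finset.mul_sum] at h1
    refine right_ne_zero_of_mul hc ?_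
    rcases mul_eq_zero.mp h1 with h2 | h2
    · exact absurd h2 (inv_ne_zero hc0)
    · simpa [q, mul_comm] using h2

/-- The resultant of the restriction of `f` to a line and its derivative. -/
noncomputable def lineResultant {F R σ : Type*} [CommRing F] [CommRing R] [Algebra F R]
    (b c : σ → R) (f : MvPolynomial σ F) : R :=
  Polynomial.resultant (lineEval b c f) (Polynomial.derivative (lineEval b c f))
    f.totalDegree (f.totalDegree - 1)

lemma map_lineResultant {F R S σ : Type*} [CommRing F] [CommRing R] [Algebra F R] [CommRing S]
    [Algebra F S] (φ : R →ₐ[F] S) (b c : σ → R) (f : MvPolynomial σ F) :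
    φ (lineResultant b c f) = lineResultant (φ ∘ b) (φ ∘ c) f := by
  rw [lineResultant, lineResultant, ← lineEval_map, Polynomial.derivative_map,
    Polynomial.resultant_map_map]
  rfl

lemma DegreeBound.deg_lineResultant_le {F R σ : Type*} [CommRing F] [CommRing R] [Algebra F R]
    (D : DegreeBound F R) {b c : σ → R} (hb : ∀ i, D.deg (b i) ≤ 1) (hc : ∀ i, D.deg (c i) ≤ 1)
    (f : MvPolynomial σ F) : D.deg (lineResultant b c f) ≤
      f.totalDegree * f.totalDegree + (f.totalDegree - 1) * f.totalDegree := by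
  refine D.deg_resultant_le _ _ (D.deg_coeff_lineEval_le hb hc f) fun k => ?_
  rw [Polynomial.coeff_derivative]
  refine (D.deg_mul_le _ _).trans ?_
  have : D.deg ((k : R) + 1) = 0 := by simpa using D.deg_algebraMap ((k : F) + 1)
  rw [this, add_zero]
  exact D.deg_coeff_lineEval_le hb hc f _

section

variable {F : Type*} [Field F] {n : ℕ}

lemma coeff_shear (v : Fin (n + 1) → F) (w : Fin n → F) (f : MvPolynomial (Fin (n + 1)) F) :
    (shear v w f).coeff f.totalDegree =
      C (eval (Fin.cons 1 w) (homogeneousComponent f.totalDegree f)) := by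
  rw [shear, coeff_lineEval _ _ _ le_rfl]
  exact aeval_algebraMap_apply (MvPolynomial (Fin n) F) (Fin.cons 1 w : Fin (n + 1) → F) _

lemma coeff_lineEval_cons (v : Fin (n + 1) → F) (w : Fin n → F) (f : MvPolynomial (Fin (n + 1)) F) :
    (lineEval v (Fin.cons 1 w) f).coeff f.totalDegree =
      eval (Fin.cons 1 w) (homogeneousComponent f.totalDegree f) := by
  rw [coeff_lineEval _ _ _ le_rfl]
  rfl

lemma exists_lineResultant_ne_zero [Infinite F] {f : MvPolynomial (Fin (n + 1)) F}
    (hf : Irreducible f) (hpd : ∃ i, pderiv i f ≠ 0) (hd : 1 ≤ f.totalDegree) :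
    ∃ (v : Fin (n + 1) → F) (w : Fin n → F), lineResultant v (Fin.cons 1 w) f ≠ 0 := by
  obtain ⟨w, hw, hw'⟩ := exists_direction hf.ne_zero hpd
  have hdeg : (shear 0 w f).natDegree = f.totalDegree := by
    refine Polynomial.natDegree_eq_of_le_of_coeff_ne_zero (natDegree_lineEval_le _ _ _) ?_
    rw [coeff_shear]
    simpa using hw
  have hu : IsUnit (shear 0 w f).leadingCoeff := by
    rw [← Polynomial.coeff_natDegree, hdeg, coeff_shear]
    exact (isUnit_iff_ne_zero.mpr hw).map C
  have hder : Polynomial.derivative (shear 0 w f) ≠ 0 := by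
    have : Polynomial.derivative (shear 0 w f) =
        shear 0 w (∑ i, C ((Fin.cons 1 w : Fin (n + 1) → F) i) * pderiv i f) := by
      rw [shear, derivative_lineEval, map_sum]
      refine Finset.sum_congr rfl fun i _ => ?_
      rw [map_mul, lineEval, aeval_C]
      rfl
    rw [this]
    exact (map_ne_zero_iff _ (shear_bijective 0 w).1).mpr hw'
  have hne := Polynomial.resultant_ne_zero_of_irreducible (irreducible_shear 0 w hf) hu hder
    (Polynomial.natDegree_derivative_lt (by omega)) hdeg
    (n := f.totalDegree - 1) (by rw [← hdeg]; exact Polynomial.natDegree_derivative_le _)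
  obtain ⟨y, hy⟩ : ∃ y, eval y (Polynomial.resultant (shear 0 w f)
      (Polynomial.derivative (shear 0 w f)) f.totalDegree (f.totalDegree - 1)) ≠ 0 := by
    by_contra! H
    exact hne (MvPolynomial.funext fun x => by simpa using H x)
  refine ⟨Fin.cons 0 y, w, ?_⟩
  change aeval y (lineResultant _ _ f) ≠ 0 at hy
  rw [map_lineResultant] at hy
  convert hy using 2
  · ext i
    refine Fin.cases ?_ (fun i => ?_) i <;> simp
  · ext i
    refine Fin.cases ?_ (fun i => ?_) i <;> simp

lemma natDegree_eq_of_lineResultant_ne_zero {v c : Fin (n + 1) → F} {f : MvPolynomial (Fin (n + 1)) F}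
    (hd : 2 ≤ f.totalDegree) (h : lineResultant v c f ≠ 0) :
    (lineEval v c f).natDegree = f.totalDegree := by
  by_contra hne
  have hlt := lt_of_le_of_ne (natDegree_lineEval_le v c f) hne
  refine h (Polynomial.resultant_eq_zero_of_lt_lt _ _ _ _ hlt ?_)
  have := Polynomial.natDegree_derivative_le (lineEval v c f)
  omega

lemma separable_of_lineResultant_ne_zero {v c : Fin (n + 1) → F} {f : MvPolynomial (Fin (n + 1)) F}
    (hd : 2 ≤ f.totalDegree) (h : lineResultant v c f ≠ 0) : (lineEval v c f).Separable := by
  have hle := natDegree_lineEval_le v c f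
  obtain ⟨p, q, -, -, hpq⟩ := Polynomial.exists_mul_add_mul_eq_C_resultant (lineEval v c f)
    (Polynomial.derivative (lineEval v c f)) hle (n := f.totalDegree - 1)
    ((Polynomial.natDegree_derivative_le _).trans (by omega)) (Or.inl (by omega))
  rw [← lineResultant] at hpq
  refine ⟨Polynomial.C (lineResultant v c f)⁻¹ * p, Polynomial.C (lineResultant v c f)⁻¹ * q, ?_⟩
  rw [mul_assoc, mul_assoc, ← mul_add, mul_comm p, mul_comm q, hpq, ← Polynomial.C_mul,
    inv_mul_cancel₀ h, Polynomial.C_1]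

end

/-- The matrix whose kernel describes the polynomials `h` of total degree less than `d` such that
`h(α, X)` vanishes to order `l`. -/
noncomputable def rootMatrix {A : Type*} [CommRing A] (α : Polynomial A) (d l : ℕ) :
    Matrix (Fin l) (Σ i : Fin d, Fin (d - i)) A :=
  Matrix.of fun k m => (α ^ (m.1 : ℕ) * Polynomial.X ^ (m.2 : ℕ)).coeff k

lemma rootMatrix_map {A B : Type*} [CommRing A] [CommRing B] (φ : A →+* B) (α : Polynomial A)
    (d l : ℕ) : (rootMatrix α d l).map φ = rootMatrix (α.map φ) d l := by
  ext k m
  simp only [rootMatrix, Matrix.map_apply, Matrix.of_apply, ← Polynomial.coeff_map,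
    Polynomial.map_mul, Polynomial.map_pow, Polynomial.map_X]

lemma rootMatrix_mulVec_eq_zero_iff {A : Type*} [CommRing A] {α : Polynomial A} {d l : ℕ}
    {h : (Σ i : Fin d, Fin (d - i)) → A} :
    (rootMatrix α d l).mulVec h = 0 ↔ Polynomial.X ^ l ∣
      ∑ m, Polynomial.C (h m) * (α ^ (m.1 : ℕ) * Polynomial.X ^ (m.2 : ℕ)) := by
  have hk (k : Fin l) : (rootMatrix α d l).mulVec h k = (∑ m, Polynomial.C (h m) *
      (α ^ (m.1 : ℕ) * Polynomial.X ^ (m.2 : ℕ))).coeff k := by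
    rw [Polynomial.finsetSum_coeff, Matrix.mulVec, dotProduct]
    refine Finset.sum_congr rfl fun m _ => ?_
    rw [Polynomial.coeff_C_mul, rootMatrix, Matrix.of_apply, mul_comm]
  rw [Polynomial.X_pow_dvd_iff]
  exact ⟨fun hz k hlt => by simpa [hz] using (hk ⟨k, hlt⟩).symm,
    fun hz => funext fun k => (hk k).trans (hz k k.2)⟩

lemma rootMatrix_ker_eq_bot {A : Type*} [CommRing A] [IsDomain A] [UniqueFactorizationMonoid A]
    {g : Polynomial (Polynomial A)} (hg : Irreducible g) (hu : IsUnit g.leadingCoeff)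
    {d l : ℕ} (hd : 1 ≤ d) (hdeg : g.natDegree = d) (hc : ∀ k, (g.coeff k).natDegree ≤ d)
    {α : Polynomial A} (hα : Polynomial.X ^ l ∣ g.eval α) (hl : 2 * (d * (d - 1)) < l)
    (h : (Σ i : Fin d, Fin (d - i)) → A) (hz : (rootMatrix α d l).mulVec h = 0) : h = 0 := by
  let H : Polynomial (Polynomial A) :=
    ∑ m, Polynomial.monomial (m.1 : ℕ) (Polynomial.monomial (m.2 : ℕ) (h m))
  have hHdeg : H.natDegree ≤ d - 1 :=
    Polynomial.natDegree_sum_le_of_forall_le _ _ fun m _ =>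
      (Polynomial.natDegree_monomial_le _).trans (by omega)
  have hHc : ∀ k, (H.coeff k).natDegree ≤ d - 1 := by
    intro k
    rw [Polynomial.finsetSum_coeff]
    refine Polynomial.natDegree_sum_le_of_forall_le _ _ fun m _ => ?_
    rw [Polynomial.coeff_monomial]
    split_ifs
    · exact (Polynomial.natDegree_monomial_le _).trans (by omega)
    · simp
  have hHα : Polynomial.X ^ l ∣ H.eval α := by
    have := rootMatrix_mulVec_eq_zero_iff.mp hz
    convert this using 1
    simp only [H, Polynomial.eval_finsetSum, Polynomial.eval_monomial]
    refine Finset.sum_congr rfl fun m _ => ?_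
    rw [← Polynomial.C_mul_X_pow_eq_monomial]
    ring
  suffices hH : H = 0 by
    ext ⟨i, j⟩
    have h1 : (H.coeff i).coeff j = h ⟨i, j⟩ := by
      rw [Polynomial.finsetSum_coeff, Polynomial.finsetSum_coeff, Finset.sum_eq_single ⟨i, j⟩]
      · simp
      · rintro ⟨i', j'⟩ - hne
        rw [Polynomial.coeff_monomial]
        split_ifs with hi
        · rw [Polynomial.coeff_monomial, if_neg]
          intro hj
          obtain rfl : i' = i := Fin.ext hi
          exact hne (by rw [show j' = j from Fin.ext hj])
        · simp
      · simp
    rw [← h1, hH]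
    simp
  by_contra hH
  have hne := Polynomial.resultant_ne_zero_of_irreducible hg hu hH (by omega) hdeg hHdeg
  obtain ⟨p, q, -, -, hpq⟩ := Polynomial.exists_mul_add_mul_eq_C_resultant g H hdeg.le hHdeg
    (Or.inl (by omega))
  have hdvd : Polynomial.X ^ l ∣ Polynomial.resultant g H d (d - 1) := by
    have := congrArg (Polynomial.eval α) hpq
    rw [Polynomial.eval_C, Polynomial.eval_add, Polynomial.eval_mul, Polynomial.eval_mul] at this
    rw [← this]
    exact dvd_add (hα.mul_right _) (hHα.mul_right _)
  have h1 : l ≤ (Polynomial.resultant g H d (d - 1)).natDegree := by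
    simpa using Polynomial.natDegree_le_of_dvd hdvd hne
  have h2 := (natDegreeBound ℤ A).deg_resultant_le d (d - 1) hc hHc
  change (Polynomial.resultant g H d (d - 1)).natDegree ≤ _ at h2
  have : (d - 1) * d = d * (d - 1) := mul_comm _ _
  omega

/-- The substitution `x_i ↦ z_i Y`. -/
noncomputable def rayHom (F : Type*) [Field F] (n : ℕ) :
    MvPolynomial (Fin n) F →ₐ[F] Polynomial (MvPolynomial (Fin n) F) :=
  aeval fun i => Polynomial.C (X i) * Polynomial.X

lemma exists_approximate_root {F : Type*} [Field F] {n : ℕ}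
    (G : Polynomial (MvPolynomial (Fin n) F)) {a : F} (h : (G.map constantCoeff).eval a = 0)
    (h' : (Polynomial.derivative (G.map constantCoeff)).eval a ≠ 0) {l : ℕ} (hl : l ≠ 0) :
    ∃ α : Polynomial (MvPolynomial (Fin n) F), (∀ k, (α.coeff k).totalDegree ≤ k) ∧
      α.coeff 0 = C a ∧ Polynomial.X ^ l ∣ (G.map (rayHom F n).toRingHom).eval α := by
  let φ := rayHom F n
  have hφ0 : ∀ b, (φ b).coeff 0 = C (constantCoeff b) := by
    intro b
    have : (Polynomial.constantCoeff (R := MvPolynomial (Fin n) F)).comp φ.toRingHom =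
        C.comp constantCoeff := by
      refine MvPolynomial.ringHom_ext (fun a => ?_) fun i => ?_ <;> simp [φ, rayHom]
    exact DFunLike.congr_fun this b
  have hC : ∀ p : Polynomial (MvPolynomial (Fin n) F),
      constantCoeff (p.eval (C a)) = (p.map constantCoeff).eval a := by
    intro p
    have := Polynomial.eval_map_apply (f := (constantCoeff : MvPolynomial (Fin n) F →+* F))
      (p := p) (C a)
    rw [constantCoeff_C] at this
    exact this.symm
  obtain ⟨b, hb, hGb⟩ := Polynomial.exists_eval_mem_pow
    (RingHom.ker (constantCoeff : MvPolynomial (Fin n) F →+* F)) G (C a)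
    (by rw [RingHom.mem_ker, hC, h])
    ⟨C ((Polynomial.derivative (G.map constantCoeff)).eval a)⁻¹, by
      rw [RingHom.mem_ker, map_sub, map_mul, hC, constantCoeff_C, ← Polynomial.derivative_map,
        inv_mul_cancel₀ h', map_one, sub_self]⟩ l hl
  rw [(RingHom.ker_isPrime _).isRadical.radical, RingHom.mem_ker, map_sub, constantCoeff_C,
    sub_eq_zero] at hb
  refine ⟨φ b, ?_, by rw [hφ0, hb], ?_⟩
  · clear hGb hb
    simp only [φ, rayHom]
    induction b using MvPolynomial.induction_on with
    | C a =>
      intro k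
      rw [aeval_C, Polynomial.algebraMap_apply, Polynomial.coeff_C]
      split_ifs
      · simp [algebraMap_eq]
      · simp
    | add p q hp hq =>
      intro k
      rw [map_add, Polynomial.coeff_add]
      exact (totalDegree_add _ _).trans (max_le (hp k) (hq k))
    | mul_X p i hp =>
      intro k
      rw [map_mul, aeval_X, ← mul_assoc]
      cases k with
      | zero => simp
      | succ k =>
        rw [Polynomial.coeff_mul_X, Polynomial.coeff_mul_C]
        refine (totalDegree_mul _ _).trans (add_le_add (hp k) ?_)
        rw [totalDegree_X]
  · have h1 : (G.map φ.toRingHom).eval (φ b) = φ (G.eval b) :=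
      Polynomial.eval_map_apply (f := φ.toRingHom)
        (p := G) b
    rw [h1, ← Ideal.mem_span_singleton, ← Ideal.span_singleton_pow]
    have h2 := Ideal.mem_map_of_mem φ.toRingHom hGb
    rw [Ideal.map_pow] at h2
    refine Ideal.pow_right_mono (Ideal.map_le_iff_le_comap.mpr fun x hx => ?_) l h2
    rw [Ideal.mem_comap, Ideal.mem_span_singleton, Polynomial.X_dvd_iff]
    have := hφ0 x
    rw [RingHom.mem_ker.mp hx, map_zero] at this
    exact this

lemma totalDegree_coeff_mul_le {F σ : Type*} [CommRing F] {p q : Polynomial (MvPolynomial σ F)}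
    (hp : ∀ k, (p.coeff k).totalDegree ≤ k) (hq : ∀ k, (q.coeff k).totalDegree ≤ k) (k : ℕ) :
    ((p * q).coeff k).totalDegree ≤ k := by
  rw [Polynomial.coeff_mul]
  refine (totalDegreeBound F σ).deg_sum_le _ _ fun x hx => (totalDegree_mul _ _).trans ?_
  exact (add_le_add (hp _) (hq _)).trans (Finset.HasAntidiagonal.mem_antidiagonal.mp hx).le

lemma totalDegree_coeff_pow_le {F σ : Type*} [CommRing F] {p : Polynomial (MvPolynomial σ F)}
    (hp : ∀ k, (p.coeff k).totalDegree ≤ k) (m k : ℕ) :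
    ((p ^ m).coeff k).totalDegree ≤ k := by
  induction m generalizing k with
  | zero =>
    rw [pow_zero, Polynomial.coeff_one]
    split_ifs <;> simp
  | succ m ih => rw [pow_succ]; exact totalDegree_coeff_mul_le ih hp k

lemma aeval_eq_sum_of_totalDegree_lt {F A : Type*} [CommRing F] [CommRing A] [Algebra F A] {d : ℕ}
    {p : MvPolynomial (Fin 2) F} (hp : p.totalDegree < d) (x y : A) :
    aeval ![x, y] p = ∑ m : (Σ i : Fin d, Fin (d - i)),
      algebraMap F A (coeff (Finsupp.single 0 (m.1 : ℕ) + Finsupp.single 1 (m.2 : ℕ)) p) *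
        (x ^ (m.1 : ℕ) * y ^ (m.2 : ℕ)) := by
  classical
  let e : (Σ i : Fin d, Fin (d - i)) → (Fin 2 →₀ ℕ) := fun m =>
    Finsupp.single 0 (m.1 : ℕ) + Finsupp.single 1 (m.2 : ℕ)
  have e0 (m) : e m 0 = m.1 := by simp [e]
  have e1 (m) : e m 1 = m.2 := by simp [e]
  have he : Function.Injective e := by
    rintro ⟨i, j⟩ ⟨i', j'⟩ h
    have h0 := DFunLike.congr_fun h 0
    have h1 := DFunLike.congr_fun h 1
    rw [e0, e0] at h0
    rw [e1, e1] at h1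
    obtain rfl : i = i' := Fin.ext h0
    rw [show j = j' from Fin.ext h1]
  have hsub : p.support ⊆ Finset.univ.image e := by
    intro m hm
    have hdeg := (le_totalDegree hm).trans_lt hp
    rw [Finsupp.sum_fintype _ _ (by simp), Fin.sum_univ_two] at hdeg
    refine Finset.mem_image.mpr ⟨⟨⟨m 0, by omega⟩, ⟨m 1, by simp; omega⟩⟩, Finset.mem_univ _, ?_⟩
    ext i
    fin_cases i
    · exact e0 _
    · exact e1 _
  rw [aeval_def, eval₂_eq', Finset.sum_subset hsub, Finset.sum_image he.injOn]
  · refine Finset.sum_congr rfl fun m _ => ?_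
    simp [Fin.prod_univ_two, e]
  · intro m _ hm
    simp [notMem_support_iff.mp hm]

lemma irreducible_of_rootMatrix {F : Type*} [Field F] {s : MvPolynomial (Fin 2) F} {d l : ℕ}
    (hs : s.totalDegree ≤ d) (hd : 1 ≤ d)
    (hdeg : (aeval ![Polynomial.X, (0 : Polynomial F)] s).natDegree = d)
    (hsep : (aeval ![Polynomial.X, (0 : Polynomial F)] s).Separable) {α : Polynomial F}
    (hα : Polynomial.X ^ l ∣ aeval ![α, Polynomial.X] s)
    (hM : ∀ h, (rootMatrix α d l).mulVec h = 0 → h = 0) : Irreducible s := by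
  have hs0 : s ≠ 0 := by
    rintro rfl
    simp at hdeg
    omega
  have key (a : MvPolynomial (Fin 2) F) (ha0 : a ≠ 0) (ha : a.totalDegree < d) :
      ¬ Polynomial.X ^ l ∣ aeval ![α, Polynomial.X] a := by
    intro hdvd
    rw [aeval_eq_sum_of_totalDegree_lt ha] at hdvd
    have := hM _ (rootMatrix_mulVec_eq_zero_iff.mpr hdvd)
    obtain ⟨m, hm⟩ := support_nonempty.mpr ha0
    have hdeg := (le_totalDegree hm).trans_lt ha
    rw [Finsupp.sum_fintype _ _ (by simp), Fin.sum_univ_two] at hdeg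
    have h1 := congrFun this ⟨⟨m 0, by omega⟩, ⟨m 1, by simp; omega⟩⟩
    have h2 : Finsupp.single 0 (m 0) + Finsupp.single 1 (m 1) = m := by
      ext i
      fin_cases i <;> simp
    refine mem_support_iff.mp hm ?_
    rw [← h2]
    exact h1
  have hunit (a : MvPolynomial (Fin 2) F) (ha0 : a ≠ 0) (ha : ¬ IsUnit a) : 1 ≤ a.totalDegree := by
    by_contra hlt
    have h1 := totalDegree_eq_zero_iff_eq_C.mp (show a.totalDegree = 0 by omega)
    refine ha ?_
    rw [h1]
    refine (isUnit_iff_ne_zero.mpr fun h0 => ha0 ?_).map C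
    rw [h1, h0, map_zero]
  have hcoeff (a : MvPolynomial (Fin 2) F) : (aeval ![α, Polynomial.X] a).coeff 0 =
      (aeval ![Polynomial.X, (0 : Polynomial F)] a).eval (α.coeff 0) := by
    have : (Polynomial.constantCoeff (R := F)).comp
        (aeval (R := F) ![α, Polynomial.X] : MvPolynomial (Fin 2) F →ₐ[F] _).toRingHom =
        (Polynomial.evalRingHom (α.coeff 0)).comp
          (aeval (R := F) ![Polynomial.X, (0 : Polynomial F)] :
            MvPolynomial (Fin 2) F →ₐ[F] _).toRingHom := by
      refine MvPolynomial.ringHom_ext (fun a => by simp) fun i => ?_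
      fin_cases i <;> simp
    exact DFunLike.congr_fun this a
  refine ⟨fun hu => ?_, fun a b hab => ?_⟩
  · have := Polynomial.natDegree_eq_zero_of_isUnit
      (hu.map (aeval ![Polynomial.X, (0 : Polynomial F)]))
    omega
  · by_contra! hnu
    have ha0 : a ≠ 0 := by
      rintro rfl
      simp_all
    have hb0 : b ≠ 0 := by
      rintro rfl
      simp_all
    have h1 := hunit a ha0 hnu.1
    have h2 := hunit b hb0 hnu.2
    have h3 := totalDegree_mul_of_isDomain ha0 hb0
    rw [← hab] at h3
    rw [hab, map_mul] at hα
    by_cases hXb : Polynomial.X ∣ aeval ![α, Polynomial.X] b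
    · by_cases hXa : Polynomial.X ∣ aeval ![α, Polynomial.X] a
      · rw [Polynomial.X_dvd_iff, hcoeff] at hXa hXb
        have hsq := hsep.squarefree
        rw [hab, map_mul] at hsq
        exact Polynomial.not_isUnit_X_sub_C _ (hsq _ (mul_dvd_mul
          (Polynomial.dvd_iff_isRoot.mpr hXa) (Polynomial.dvd_iff_isRoot.mpr hXb)))
      · exact key b hb0 (by omega) (Polynomial.prime_X.pow_dvd_of_dvd_mul_left _ hXa hα)
    · exact key a ha0 (by omega) (Polynomial.prime_X.pow_dvd_of_dvd_mul_right _ hXb hα)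

section planeSlice

variable {F : Type*} [Field F] {n : ℕ}

/-- The restriction of `f` to the plane through `v` spanned by `(1, w)` and `(0, z)`. -/
noncomputable def planeSlice (v : Fin (n + 1) → F) (w z : Fin n → F) :
    MvPolynomial (Fin (n + 1)) F →ₐ[F] MvPolynomial (Fin 2) F :=
  aeval fun i => C (v i) + C ((Fin.cons 1 w : Fin (n + 1) → F) i) * X 0 +
    C ((Fin.cons 0 z : Fin (n + 1) → F) i) * X 1

lemma totalDegree_planeSlice_le (v : Fin (n + 1) → F) (w z : Fin n → F)
    (f : MvPolynomial (Fin (n + 1)) F) : (planeSlice v w z f).totalDegree ≤ f.totalDegree := by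
  have hX (a : F) (i : Fin 2) : (C a * X i : MvPolynomial (Fin 2) F).totalDegree ≤ 1 :=
    (totalDegree_mul _ _).trans (by rw [totalDegree_C, totalDegree_X])
  refine (totalDegreeBound F (Fin 2)).deg_aeval_le _ (fun i => ?_) f
  refine (totalDegree_add _ _).trans
    (max_le ((totalDegree_add _ _).trans (max_le ?_ (hX _ _))) (hX _ _))
  rw [totalDegree_C]
  exact zero_le_one

lemma aeval_X_zero_planeSlice (v : Fin (n + 1) → F) (w z : Fin n → F)
    (f : MvPolynomial (Fin (n + 1)) F) :
    aeval ![Polynomial.X, (0 : Polynomial F)] (planeSlice v w z f) =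
      lineEval v (Fin.cons 1 w) f := by
  have : (aeval (R := F) ![Polynomial.X, (0 : Polynomial F)]).comp (planeSlice v w z) =
      lineEval v (Fin.cons 1 w) := by
    ext i : 1
    simp [planeSlice, lineEval]
  exact DFunLike.congr_fun this f

lemma shear_map_constantCoeff (v : Fin (n + 1) → F) (w : Fin n → F)
    (f : MvPolynomial (Fin (n + 1)) F) :
    (shear v w f).map constantCoeff = lineEval v (Fin.cons 1 w) f := by
  have : (Polynomial.mapRingHom constantCoeff).comp (shear v w).toRingHom =
      (lineEval v (Fin.cons 1 w)).toRingHom := by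
    refine MvPolynomial.ringHom_ext (fun a => ?_) fun i => ?_
    · simp [shear, lineEval]
    · refine Fin.cases ?_ (fun i => ?_) i <;> simp [shear, lineEval]
  exact DFunLike.congr_fun this f

lemma map_eval_shear (v : Fin (n + 1) → F) (w z : Fin n → F)
    (α : Polynomial (MvPolynomial (Fin n) F)) (f : MvPolynomial (Fin (n + 1)) F) :
    (((shear v w f).map (rayHom F n).toRingHom).eval α).map (eval z) =
      aeval ![α.map (eval z), Polynomial.X] (planeSlice v w z f) := by
  have : ((Polynomial.mapRingHom (eval z)).comp (Polynomial.evalRingHom α)).comp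
      ((Polynomial.mapRingHom (rayHom F n).toRingHom).comp (shear v w).toRingHom) =
      (aeval (R := F) ![α.map (eval z), Polynomial.X]).toRingHom.comp
        (planeSlice v w z).toRingHom := by
    refine MvPolynomial.ringHom_ext (fun a => ?_) fun i => ?_
    · simp [shear, lineEval, planeSlice, rayHom]
    · refine Fin.cases ?_ (fun i => ?_) i
      · simp [shear, lineEval, planeSlice, rayHom]
      · simp [shear, lineEval, planeSlice, rayHom]
        ring
  exact DFunLike.congr_fun this f

lemma irreducible_shear_map_rayHom (v : Fin (n + 1) → F) (w : Fin n → F)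
    {f : MvPolynomial (Fin (n + 1)) F} (hf : Irreducible f)
    (hu : IsUnit (shear v w f).leadingCoeff) :
    Irreducible ((shear v w f).map (rayHom F n).toRingHom) := by
  refine Polynomial.irreducible_of_irreducible_map_of_isUnit_leadingCoeff
    (Polynomial.evalRingHom 1) ?_ ?_
  · rw [Polynomial.leadingCoeff_map_of_leadingCoeff_ne_zero _ (hu.map _).ne_zero]
    exact hu.map _
  · have : (Polynomial.evalRingHom 1).comp (rayHom F n).toRingHom = RingHom.id _ := by
      refine MvPolynomial.ringHom_ext (fun a => ?_) fun i => ?_ <;> simp [rayHom]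
    rw [Polynomial.map_map, this, Polynomial.map_id]
    exact irreducible_shear v w hf

lemma natDegree_coeff_shear_map_rayHom_le (v : Fin (n + 1) → F) (w : Fin n → F)
    (f : MvPolynomial (Fin (n + 1)) F) (k : ℕ) :
    (((shear v w f).map (rayHom F n).toRingHom).coeff k).natDegree ≤ f.totalDegree := by
  have h : (shear v w f).map (rayHom F n).toRingHom = _ := lineEval_map (rayHom F n) _ _ f
  rw [h]
  refine (natDegreeBound F (MvPolynomial (Fin n) F)).deg_coeff_lineEval_le (fun i => ?_)
    (fun i => ?_) f k
  · change (rayHom F n (C (v i) +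
      (Fin.cons 0 X : Fin (n + 1) → MvPolynomial (Fin n) F) i)).natDegree ≤ 1
    refine Fin.cases ?_ (fun i => ?_) i
    · simp [rayHom]
    · simp only [rayHom, map_add, aeval_C, Fin.cons_succ, aeval_X, Polynomial.algebraMap_apply]
      compute_degree
  · change (rayHom F n (C ((Fin.cons 1 w : Fin (n + 1) → F) i))).natDegree ≤ 1
    simp [rayHom]

lemma exists_planeSlice_discriminant [IsAlgClosed F] {f : MvPolynomial (Fin (n + 1)) F}
    (hf : Irreducible f) (hd : 2 ≤ f.totalDegree) {v : Fin (n + 1) → F} {w : Fin n → F}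
    (h : lineResultant v (Fin.cons 1 w) f ≠ 0) :
    ∃ Δ : MvPolynomial (Fin n) F, Δ ≠ 0 ∧
      Δ.totalDegree ≤ f.totalDegree ^ 2 * ((f.totalDegree + 1) * (f.totalDegree - 1)) ∧
      ∀ z, eval z Δ ≠ 0 → Irreducible (planeSlice v w z f) := by
  set d := f.totalDegree with hdd
  have hPdeg := natDegree_eq_of_lineResultant_ne_zero hd h
  have hsep := separable_of_lineResultant_ne_zero hd h
  have hc0 : eval (Fin.cons 1 w) (homogeneousComponent d f) ≠ 0 := by
    rw [hdd, ← coeff_lineEval_cons v, ← hPdeg, Polynomial.coeff_natDegree,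
      Polynomial.leadingCoeff_ne_zero]
    intro h0
    rw [h0, Polynomial.natDegree_zero] at hPdeg
    omega
  have hGdeg : (shear v w f).natDegree = d := by
    refine Polynomial.natDegree_eq_of_le_of_coeff_ne_zero (natDegree_lineEval_le _ _ _) ?_
    rw [coeff_shear]
    simpa using hc0
  have hu : IsUnit (shear v w f).leadingCoeff := by
    rw [← Polynomial.coeff_natDegree, hGdeg, coeff_shear]
    exact (isUnit_iff_ne_zero.mpr hc0).map C
  obtain ⟨a, ha⟩ := IsAlgClosed.exists_root (lineEval v (Fin.cons 1 w) f) (by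
    intro h0
    have := Polynomial.natDegree_eq_zero_iff_degree_le_zero.mpr h0.le
    omega)
  have ha' : (Polynomial.derivative (lineEval v (Fin.cons 1 w) f)).eval a ≠ 0 :=
    hsep.eval₂_derivative_ne_zero (RingHom.id F) ha
  set l := 2 * (d * (d - 1)) + 1 with hl
  obtain ⟨α, hα, -, hroot⟩ := exists_approximate_root (shear v w f) (a := a)
    (by rwa [shear_map_constantCoeff]) (by rwa [shear_map_constantCoeff]) (l := l) (by omega)
  have hker := rootMatrix_ker_eq_bot (l := l) (irreducible_shear_map_rayHom v w hf hu)
    (by rw [Polynomial.leadingCoeff_map_of_leadingCoeff_ne_zero _ (hu.map _).ne_zero]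
        exact hu.map _)
    (show 1 ≤ d by omega)
    (by rw [Polynomial.natDegree_map_eq_of_isUnit_leadingCoeff _ hu, hGdeg])
    (natDegree_coeff_shear_map_rayHom_le v w f) hroot (by omega)
  obtain ⟨e, he⟩ := Matrix.exists_submatrix_det_ne_zero _ hker
  refine ⟨_, he, ?_, fun z hz => ?_⟩
  · have hentry (k : Fin l) (m : Σ i : Fin d, Fin (d - i)) :
        (rootMatrix α d l k m).totalDegree ≤ 2 * (d * (d - 1)) := by
      refine (totalDegree_coeff_mul_le (q := Polynomial.X ^ (m.2 : ℕ))
        (totalDegree_coeff_pow_le hα _) (fun j => ?_) _).trans (by omega)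
      rw [Polynomial.coeff_X_pow]
      split_ifs <;> simp
    have h1 := (totalDegreeBound F (Fin n)).deg_det_le ((rootMatrix α d l).submatrix e id)
      (fun _ => 2 * (d * (d - 1))) fun i j => hentry _ _
    refine h1.trans (le_of_eq ?_)
    rw [Finset.sum_const, Finset.card_univ, Fintype.card_sigma]
    simp only [Fintype.card_fin, smul_eq_mul]
    have hcard : (∑ i : Fin d, (d - i)) * 2 = d * (d + 1) := by
      rw [Fin.sum_univ_eq_sum_range (fun i => d - i)]
      clear_value d
      clear * -
      induction d with
      | zero => simp
      | succ d ih =>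
        simp only [Finset.sum_range_succ', Nat.add_sub_add_right, Nat.sub_zero, add_mul, ih]
        ring
    calc _ = ((∑ i : Fin d, (d - i)) * 2) * (d * (d - 1)) := by ring
      _ = _ := by rw [hcard]; ring
  · refine irreducible_of_rootMatrix (d := d) (l := l) (α := α.map (eval z))
      (totalDegree_planeSlice_le _ _ _ _) (by omega) (by rw [aeval_X_zero_planeSlice, hPdeg])
      (by rwa [aeval_X_zero_planeSlice]) ?_ fun x hx => ?_
    · rw [← map_eval_shear]
      have := map_dvd (Polynomial.mapRingHom (eval z)) hroot
      rwa [map_pow, Polynomial.coe_mapRingHom, Polynomial.map_X] at this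
    · rw [RingHom.map_det] at hz
      refine Matrix.eq_zero_of_mulVec_eq_zero hz ?_
      rw [← rootMatrix_map] at hx
      ext i
      exact congrFun hx (e i)

end planeSlice

lemma card_zeros_mul_card_le {K F : Type*} [Field K] [Fintype K] [Field F] [Algebra K F] {m : ℕ}
    {p : MvPolynomial (Fin m) F} (hp : p ≠ 0) :
    Nat.card {x : Fin m → K | eval (fun i => algebraMap K F (x i)) p = 0} * Fintype.card K ≤
      p.totalDegree * Fintype.card K ^ m := by
  classical
  let S : Finset F := Finset.univ.map ⟨algebraMap K F, (algebraMap K F).injective⟩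
  have hS : S.card = Fintype.card K := by simp [S]
  have hle : Nat.card {x : Fin m → K | eval (fun i => algebraMap K F (x i)) p = 0} ≤
      (Finset.filter (fun y => eval y p = 0) (Fintype.piFinset fun _ => S)).card := by
    rw [← Fintype.card_coe, ← Nat.card_eq_fintype_card]
    refine Nat.card_le_card_of_injective
      (fun x => ⟨fun i => algebraMap K F (x.1 i), Finset.mem_filter.mpr ⟨by simp [S], x.2⟩⟩)
      fun x y hxy => ?_
    ext i
    exact (algebraMap K F).injective (congrFun (Subtype.ext_iff.mp hxy) i)
  have h1 := schwartz_zippel_totalDegree hp S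
  have hq : (0 : ℚ≥0) < Fintype.card K := by exact_mod_cast Fintype.card_pos
  rw [hS, div_le_div_iff₀ (pow_pos hq _) hq] at h1
  exact (Nat.mul_le_mul_right _ hle).trans (by exact_mod_cast h1)

lemma card_mul_le_of_fiberwise {ι κ τ : Type*} [Fintype ι] [Fintype κ] [Fintype τ]
    {s : Set ι} {a : ι → κ} {b : ι → τ} (hab : Function.Injective fun x => (a x, b x)) {D q N : ℕ}
    (h : ∀ x ∈ s, ∃ T : Set τ, (∀ y ∈ s, a y = a x → b y ∈ T) ∧ Nat.card T * q ≤ D * N) :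
    Nat.card s * q ≤ Fintype.card κ * (D * N) := by
  classical
  rw [Nat.card_eq_fintype_card, ← Set.toFinset_card,
    Finset.card_eq_sum_card_fiberwise (f := a) (t := Finset.univ) (by simp [Set.MapsTo]),
    Finset.sum_mul]
  refine (Finset.sum_le_card_nsmul _ _ (D * N) fun u _ => ?_).trans_eq (by simp)
  rcases Finset.eq_empty_or_nonempty {y ∈ s.toFinset | a y = u} with h0 | ⟨x, hx⟩
  · simp [h0]
  · rw [Finset.mem_filter, Set.mem_toFinset] at hx
    obtain ⟨T, hT, hTq⟩ := h x hx.1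
    refine le_trans (Nat.mul_le_mul_right _ ?_) hTq
    rw [Nat.card_eq_fintype_card, ← Set.toFinset_card]
    refine Finset.card_le_card_of_injOn b (fun y hy => ?_) fun y hy z hz hyz => ?_
    · simp only [Finset.coe_filter, Set.mem_toFinset, Set.mem_ofPred_eq] at hy
      simpa using hT y hy.1 (hy.2.trans hx.2.symm)
    · simp only [Finset.coe_filter, Set.mem_toFinset, Set.mem_ofPred_eq] at hy hz
      exact hab (Prod.ext (hy.2.trans hz.2.symm) hyz)

lemma map_slicedPoly {K F : Type*} [Field K] [Field F] [Algebra K F] {n : ℕ}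
    (f : MvPolynomial (Fin (n + 1)) K) (ξ : Fin (3 * n + 1) → K) :
    map (algebraMap K F) (slicedPoly f ξ) =
      planeSlice (fun i => algebraMap K F (ξ ⟨i, by omega⟩))
        (fun j => algebraMap K F (ξ ⟨n + (j + 1), by omega⟩))
        (fun j => algebraMap K F (ξ ⟨2 * n + (j + 1), by omega⟩)) (map (algebraMap K F) f) := by
  have h (φ ψ : MvPolynomial (Fin (n + 1)) K →+* MvPolynomial (Fin 2) F) (hφψ : φ = ψ) :
    φ f = ψ f := by rw [hφψ]
  refine h ((map (algebraMap K F)).comp (AlgHom.toRingHom (aeval _)))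
    ((planeSlice _ _ _).toRingHom.comp (map (algebraMap K F))) ?_
  refine MvPolynomial.ringHom_ext (fun a => ?_) fun i => ?_
  · simp [planeSlice, algebraMap_eq]
  · refine Fin.cases ?_ (fun i => ?_) i <;> simp [planeSlice]

/-- The discriminant of the restriction of `f` to the line of a generic slice. -/
noncomputable def sliceDiscriminant {F : Type*} [Field F] {n : ℕ}
    (f : MvPolynomial (Fin (n + 1)) F) : MvPolynomial (Fin (3 * n + 1)) F :=
  lineResultant (fun i : Fin (n + 1) => X ⟨i, by omega⟩)
    (Fin.cons 1 fun j => X ⟨n + (j + 1), by omega⟩) f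

section sliceDiscriminant

variable {F : Type*} [Field F] {n : ℕ} (f : MvPolynomial (Fin (n + 1)) F)

lemma eval_sliceDiscriminant (x : Fin (3 * n + 1) → F) :
    eval x (sliceDiscriminant f) = lineResultant (fun i : Fin (n + 1) => x ⟨i, by omega⟩)
      (Fin.cons 1 fun j => x ⟨n + (j + 1), by omega⟩) f := by
  change aeval x (sliceDiscriminant f) = _
  rw [sliceDiscriminant, map_lineResultant]
  congr 1
  · ext i
    simp
  · ext i
    refine Fin.cases ?_ (fun i => ?_) i <;> simp

lemma totalDegree_sliceDiscriminant_le : (sliceDiscriminant f).totalDegree ≤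
    f.totalDegree * f.totalDegree + (f.totalDegree - 1) * f.totalDegree := by
  refine (totalDegreeBound F (Fin (3 * n + 1))).deg_lineResultant_le (fun i => ?_) (fun i => ?_) f
  · exact (totalDegree_X _).le
  · change totalDegree _ ≤ 1
    refine Fin.cases ?_ (fun i => ?_) i <;> simp

lemma sliceDiscriminant_ne_zero [Infinite F] (hf : Irreducible f) (hpd : ∃ i, pderiv i f ≠ 0)
    (hd : 1 ≤ f.totalDegree) : sliceDiscriminant f ≠ 0 := by
  obtain ⟨v, w, h⟩ := exists_lineResultant_ne_zero hf hpd hd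
  intro h0
  refine h ?_
  have h1 := eval_sliceDiscriminant f fun k => if h : k.val < n + 1 then v ⟨k, h⟩ else
    if h : k.val - (n + 1) < n then w ⟨k - (n + 1), h⟩ else 0
  rw [h0, map_zero] at h1
  rw [h1]
  congr 1
  · ext i
    rw [dif_pos i.isLt]
  · ext i
    refine Fin.cases ?_ (fun i => ?_) i
    · simp
    · have : n + (i.val + 1) - (n + 1) = i := by omega
      simp [this]

end sliceDiscriminant

lemma exists_pderiv_ne_zero_of_algebraicClosure {K σ : Type*} [Field K] [Finite K] [Finite σ]
    {f : MvPolynomial σ (AlgebraicClosure K)} (hf : Irreducible f) : ∃ i, pderiv i f ≠ 0 := by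
  obtain ⟨p, hp⟩ := CharP.exists K
  have : Fact p.Prime := ⟨CharP.char_is_prime K p⟩
  have : CharP (AlgebraicClosure K) p :=
    charP_of_injective_algebraMap (algebraMap K (AlgebraicClosure K)).injective p
  have : PerfectRing (AlgebraicClosure K) p := PerfectField.toPerfectRing p
  exact exists_pderiv_ne_zero_of_irreducible (p := p) hf

/-- **Lemma 4 (Kaltofen; Cafure & Matera).** Let `f ∈ 𝔽_q[x_0, …, x_n]` be absolutely
irreducible of degree `d ≥ 2`.  Then the number of slices `ξ ∈ 𝔽_q^{3n+1}` for which the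
sliced polynomial `f|_ξ` is not absolutely irreducible is at most
`(1/2)(3d⁴ - 4d³ + 5d²) q^{3n}`. -/
theorem kaltofen_cafure_matera_bertini
    {K : Type*} [Field K] [Fintype K] {n : ℕ} {d : ℕ} (hd : 2 ≤ d)
    (f : MvPolynomial (Fin (n + 1)) K) (hdeg : f.totalDegree = d)
    (hirr : Irreducible (MvPolynomial.map (algebraMap K (AlgebraicClosure K)) f)) :
    (Set.ncard {ξ : Fin (3 * n + 1) → K |
        ¬ Irreducible
          (MvPolynomial.map (algebraMap K (AlgebraicClosure K)) (slicedPoly f ξ))} : ℝ) ≤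
      (1 / 2 : ℝ) * (3 * (d : ℝ) ^ 4 - 4 * (d : ℝ) ^ 3 + 5 * (d : ℝ) ^ 2) *
        (Fintype.card K : ℝ) ^ (3 * n) := by
  set F := AlgebraicClosure K
  set q := Fintype.card K
  set g := map (algebraMap K F) f
  have hgd : g.totalDegree = d := by
    rw [← hdeg, totalDegree, totalDegree, support_map_of_injective _ (algebraMap K F).injective]
  let A : Set (Fin (3 * n + 1) → K) :=
    {ξ | eval (fun i => algebraMap K F (ξ i)) (sliceDiscriminant g) = 0}
  let B : Set (Fin (3 * n + 1) → K) :=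
    {ξ | ξ ∉ A ∧ ¬ Irreducible (map (algebraMap K F) (slicedPoly f ξ))}
  have hA : Nat.card A * q ≤ (d * d + (d - 1) * d) * q ^ (3 * n + 1) := by
    refine (card_zeros_mul_card_le (sliceDiscriminant_ne_zero g hirr
      (exists_pderiv_ne_zero_of_algebraicClosure hirr) (by omega))).trans (Nat.mul_le_mul_right _ ?_)
    have := totalDegree_sliceDiscriminant_le g
    rwa [hgd] at this
  have hB : Nat.card B * q ≤ d ^ 2 * ((d + 1) * (d - 1)) * q ^ (3 * n + 1) := by
    refine (card_mul_le_of_fiberwise (s := B)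
      (a := fun ξ (i : Fin (2 * n + 1)) => ξ ⟨i, by omega⟩)
      (b := fun ξ (j : Fin n) => ξ ⟨2 * n + (j + 1), by omega⟩) (fun ξ ζ h => ?_)
      (D := d ^ 2 * ((d + 1) * (d - 1))) (N := q ^ n) fun ξ hξ => ?_).trans_eq ?_
    · ext k
      by_cases hk : k.val < 2 * n + 1
      · exact congrFun (Prod.ext_iff.mp h).1 ⟨k, hk⟩
      · have := congrFun (Prod.ext_iff.mp h).2 ⟨k - (2 * n + 1), by omega⟩
        have hk' : (⟨2 * n + (k.val - (2 * n + 1) + 1), by omega⟩ : Fin (3 * n + 1)) = k :=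
          Fin.ext (by simp only []; omega)
        simpa only [hk'] using this
    · have hres := hξ.1
      change ¬ (eval _ _ = _) at hres
      rw [eval_sliceDiscriminant] at hres
      obtain ⟨Δ, hΔ, hΔd, hΔz⟩ := exists_planeSlice_discriminant hirr (by omega) hres
      refine ⟨_, fun ζ hζ hζξ => ?_, (card_zeros_mul_card_le (K := K) hΔ).trans
        (Nat.mul_le_mul_right _ (by rwa [hgd] at hΔd))⟩
      by_contra hne
      refine hζ.2 ?_
      have h1 := hΔz _ hne
      rw [map_slicedPoly]
      have hv (i : Fin (n + 1)) (hi : i.val < 3 * n + 1) : ζ ⟨i, hi⟩ = ξ ⟨i, hi⟩ :=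
        congrFun hζξ ⟨i, by omega⟩
      have hw (j : Fin n) : ζ ⟨n + (j + 1), by omega⟩ = ξ ⟨n + (j + 1), by omega⟩ :=
        congrFun hζξ ⟨n + (j + 1), by omega⟩
      simpa only [hv, hw] using h1
    · simp only [Fintype.card_fun, Fintype.card_fin]
      ring
  have hncard : Set.ncard {ξ : Fin (3 * n + 1) → K |
      ¬ Irreducible (map (algebraMap K F) (slicedPoly f ξ))} ≤ Nat.card A + Nat.card B := by
    rw [Nat.card_coe_set_eq, Nat.card_coe_set_eq]
    refine (Set.ncard_le_ncard (fun ξ hξ => ?_) (Set.toFinite _)).trans (Set.ncard_union_le A B)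
    by_cases h : ξ ∈ A
    · exact Or.inl h
    · exact Or.inr ⟨h, hξ⟩
  have hq : 0 < q := Fintype.card_pos
  have htotal : Nat.card A + Nat.card B ≤
      (d * d + (d - 1) * d + d ^ 2 * ((d + 1) * (d - 1))) * q ^ (3 * n) := by
    refine Nat.le_of_mul_le_mul_right ?_ hq
    calc _ = Nat.card A * q + Nat.card B * q := add_mul _ _ _
      _ ≤ _ := add_le_add hA hB
      _ = _ := by ring
  refine (Nat.cast_le.mpr (hncard.trans htotal)).trans ?_
  rw [Nat.cast_mul, Nat.cast_pow]
  refine mul_le_mul_of_nonneg_right ?_ (by positivity)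
  obtain ⟨e, rfl⟩ := Nat.exists_eq_add_of_le' hd
  have he : (e : ℝ) ≤ (e : ℝ) ^ 2 := by exact_mod_cast Nat.le_self_pow two_ne_zero e
  have he0 : (0 : ℝ) ≤ e := Nat.cast_nonneg e
  rw [show e + 2 - 1 = e + 1 by omega]
  push_cast
  nlinarith [mul_nonneg he0 (pow_nonneg he0 2), mul_nonneg he0 (sub_nonneg.mpr he),
    mul_nonneg he0 (mul_nonneg he0 (pow_nonneg he0 2)), pow_nonneg he0 2]
end

section
/- Let q be a prime power, 𝔽_q the finite field with q elements, n ≥ 2, and let G ∈ 𝔽_q[x_1,…,x_n] be an absolutely irreducible polynomial of total degree d ≥ 1. Then the number of singular 𝔽_q-zeros of G satisfies #{x ∈ 𝔽_q^n : G(x) = 0 and ∇G(x) = 0} ≤ d(d−1)·q^{n−2}. -/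
open MvPolynomial

/-- An integral extension does not decrease the Krull dimension. -/
lemma ringKrullDim_le_of_isIntegral_of_injective {R S : Type*} [CommRing R] [CommRing S]
    [Algebra R S] [Algebra.IsIntegral R S] (h : Function.Injective (algebraMap R S)) :
    ringKrullDim R ≤ ringKrullDim S := by
  refine iSup_le fun l ↦ ?_
  obtain ⟨Q, hQ, hQl⟩ := Ideal.exists_ideal_over_prime_of_isIntegral l.head.asIdeal
    (⊥ : Ideal S) (by
      rw [← RingHom.ker_eq_comap_bot, (RingHom.injective_iff_ker_eq_bot _).mp h]
      exact bot_le)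
  obtain ⟨hQ, hQl⟩ := hQl
  have : Q.LiesOver l.head.asIdeal := ⟨hQl.symm⟩
  obtain ⟨L, hL, -⟩ := Ideal.exists_ltSeries_of_hasGoingUp (S := S) l Q
  rw [← hL]
  exact le_iSup (fun p : LTSeries (PrimeSpectrum S) ↦ ((p.length : ℕ) : WithBot ℕ∞)) L

/-- An integral extension does not increase the Krull dimension. -/
lemma ringKrullDim_le_of_isIntegral {R S : Type*} [CommRing R] [CommRing S]
    [Algebra R S] [Algebra.IsIntegral R S] : ringKrullDim S ≤ ringKrullDim R :=
  Order.krullDim_le_of_strictMono (PrimeSpectrum.comap (algebraMap R S)) fun _ _ h ↦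
    Ideal.IsIntegral.comap_lt_comap h

/-- Every maximal ideal of `K[X₁, …, Xₛ]` has height at least `s`. -/
lemma le_height_of_isMaximal {K : Type*} [Field K] (s : ℕ) (M : Ideal (MvPolynomial (Fin s) K))
    [hM : M.IsMaximal] : (s : ℕ∞) ≤ M.height := by
  induction s with
  | zero => simp
  | succ s ih =>
    let e := (finSuccEquiv K s).toRingEquiv
    let N := M.map e
    have hN : N.IsMaximal := Ideal.map_isMaximal_of_equiv e
    have : (N.under (MvPolynomial (Fin s) K)).IsMaximal :=
      Polynomial.isMaximal_comap_C_of_isJacobsonRing N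
    have hlo : N.LiesOver (N.under (MvPolynomial (Fin s) K)) := ⟨rfl⟩
    have h := Polynomial.height_eq_height_add_one (N.under (MvPolynomial (Fin s) K)) N
    rw [← RingEquiv.height_map e M]
    change _ ≤ N.height
    rw [h]
    push_cast
    gcongr
    exact ih _

/-- A prime of height at most one in `K[X₁, …, Xₛ]` has coheight at least `s - 1`. -/
lemma le_ringKrullDim_quotient_add_one {K : Type*} [Field K] (s : ℕ)
    (p : Ideal (MvPolynomial (Fin s) K)) [hp : p.IsPrime] (h : p.height ≤ 1) :
    (s : WithBot ℕ∞) ≤ ringKrullDim (MvPolynomial (Fin s) K ⧸ p) + 1 := by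
  obtain ⟨g, hg⟩ : ∃ g, p = Ideal.span {g} := by
    by_cases h0 : p = ⊥
    · exact ⟨0, by simp [h0]⟩
    obtain ⟨g, hgp, hg⟩ := Ideal.IsPrime.exists_mem_prime_of_ne_bot hp h0
    have hgpr : (Ideal.span {g}).IsPrime := (Ideal.span_singleton_prime hg.ne_zero).mpr hg
    refine ⟨g, ?_⟩
    by_contra hne
    have hlt : Ideal.span {g} < p :=
      lt_of_le_of_ne ((Ideal.span_singleton_le_iff_mem _).mpr hgp) (Ne.symm hne)
    have h1 : (⊥ : Ideal (MvPolynomial (Fin s) K)) < Ideal.span {g} := by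
      rw [bot_lt_iff_ne_bot, Ne, Ideal.span_singleton_eq_bot]
      exact hg.ne_zero
    have h2 := Ideal.height_add_one_le_of_lt_of_isPrime hlt
    have h3 := Ideal.height_add_one_le_of_lt_of_isPrime h1
    have : (2 : ℕ∞) ≤ 1 := calc
      (2 : ℕ∞) = 0 + 1 + 1 := by norm_num
      _ ≤ (⊥ : Ideal (MvPolynomial (Fin s) K)).height + 1 + 1 := by gcongr; exact zero_le
      _ ≤ (Ideal.span {g}).height + 1 := by gcongr
      _ ≤ 1 := h2.trans h
    exact absurd this (by norm_num)
  obtain ⟨M, hM, hpM⟩ := p.exists_le_maximal hp.ne_top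
  have hgM : g ∈ M := hpM (hg ▸ Ideal.mem_span_singleton_self g)
  subst hg
  refine le_trans ?_ (Ideal.height_le_ringKrullDim_quotient_add_one hgM)
  exact_mod_cast le_height_of_isMaximal s M

/-- In a domain integral over a polynomial ring over a field, a prime of height at most one has
coheight at least the dimension minus one. -/
lemma ringKrullDim_le_ringKrullDim_quotient_add_one_of_isIntegral {K : Type*} [Field K] {s : ℕ}
    {A : Type*} [CommRing A] [IsDomain A] [IsNoetherianRing A] [Algebra (MvPolynomial (Fin s) K) A]
    [Algebra.IsIntegral (MvPolynomial (Fin s) K) A] [FaithfulSMul (MvPolynomial (Fin s) K) A]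
    (q : Ideal A) [q.IsPrime] (hq : q.height ≤ 1) :
    ringKrullDim A ≤ ringKrullDim (A ⧸ q) + 1 := by
  have hp : (q.under (MvPolynomial (Fin s) K)).height ≤ 1 := by
    rw [Ideal.height_eq_height_add_of_liesOver_of_hasGoingDown
      (q.under (MvPolynomial (Fin s) K)) q] at hq
    exact le_self_add.trans hq
  have hpq : ringKrullDim (MvPolynomial (Fin s) K ⧸ q.under (MvPolynomial (Fin s) K)) ≤
      ringKrullDim (A ⧸ q) :=
    ringKrullDim_le_of_isIntegral_of_injective Ideal.algebraMap_quotient_injective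
  calc ringKrullDim A ≤ ringKrullDim (MvPolynomial (Fin s) K) := ringKrullDim_le_of_isIntegral
    _ = (s : WithBot ℕ∞) := by simp [MvPolynomial.ringKrullDim_of_isNoetherianRing]
    _ ≤ _ := le_ringKrullDim_quotient_add_one s _ hp
    _ ≤ ringKrullDim (A ⧸ q) + 1 := by gcongr

/-- Cutting an affine variety by a hypersurface drops the dimension of every component by at
most one. -/
lemma ringKrullDim_quotient_le_add_one {K : Type*} [Field K] {n : ℕ}
    {P Q : Ideal (MvPolynomial (Fin n) K)} [hP : P.IsPrime] {f : MvPolynomial (Fin n) K}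
    (hQ : Q ∈ (P ⊔ Ideal.span {f}).minimalPrimes) :
    ringKrullDim (MvPolynomial (Fin n) K ⧸ P) ≤
      ringKrullDim (MvPolynomial (Fin n) K ⧸ Q) + 1 := by
  have hQp : Q.IsPrime := hQ.1.1
  have hPQ : P ≤ Q := le_sup_left.trans hQ.1.2
  obtain ⟨s, -, g, hg, hgi⟩ := exists_integral_inj_algHom_of_quotient P hP.ne_top
  have hq : (Q.map (Ideal.Quotient.mk P)).IsPrime := Ideal.isPrime_map_quotientMk_of_isPrime hPQ
  have hq1 : (Q.map (Ideal.Quotient.mk P)).height ≤ 1 :=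
    Ideal.map_height_le_one_of_mem_minimalPrimes hQ
  let _ : Algebra (MvPolynomial (Fin s) K) (MvPolynomial (Fin n) K ⧸ P) := g.toRingHom.toAlgebra
  have : Algebra.IsIntegral (MvPolynomial (Fin s) K) (MvPolynomial (Fin n) K ⧸ P) := ⟨hgi⟩
  have : FaithfulSMul (MvPolynomial (Fin s) K) (MvPolynomial (Fin n) K ⧸ P) :=
    (faithfulSMul_iff_algebraMap_injective _ _).mpr hg
  rw [← ringKrullDim_eq_of_ringEquiv (DoubleQuot.quotQuotEquivQuotOfLE hPQ)]
  exact ringKrullDim_le_ringKrullDim_quotient_add_one_of_isIntegral (K := K) (s := s) _ hq1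

/-- The image in `K[X₁, …, Xₙ] ⧸ I` of the polynomials of degree at most `s`. -/
noncomputable def quotientDegreeLE {K : Type*} [Field K] {n : ℕ}
    (I : Ideal (MvPolynomial (Fin n) K)) (s : ℕ) : Submodule K (MvPolynomial (Fin n) K ⧸ I) :=
  (restrictTotalDegree (Fin n) K s).map (Ideal.Quotient.mkₐ K I).toLinearMap

/-- The affine Hilbert function of an ideal of `K[X₁, …, Xₙ]`. -/
noncomputable def hilbertFunction {K : Type*} [Field K] {n : ℕ}
    (I : Ideal (MvPolynomial (Fin n) K)) (s : ℕ) : ℕ :=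
  Module.finrank K (quotientDegreeLE I s)

/-- The affine Hilbert function of `I` grows at least like `A / B * (s + r).choose r`. -/
def HilbertGrowth {K : Type*} [Field K] {n : ℕ} (I : Ideal (MvPolynomial (Fin n) K))
    (A B r : ℕ) : Prop :=
  ∃ e, ∀ s, A * (s + r).choose r ≤ B * hilbertFunction I (s + e)

/-- The set of `K`-rational points of the variety defined by an ideal. -/
def rationalPoints {K : Type*} [Field K] {n : ℕ} (I : Ideal (MvPolynomial (Fin n) K)) :
    Set (Fin n → K) :=
  {x | ∀ p ∈ I, eval x p = 0}

section HilbertFunction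

variable {K : Type*} [Field K] {n : ℕ}

instance (I : Ideal (MvPolynomial (Fin n) K)) (s : ℕ) :
    FiniteDimensional K (quotientDegreeLE I s) := by
  unfold quotientDegreeLE
  infer_instance

lemma mem_quotientDegreeLE {I : Ideal (MvPolynomial (Fin n) K)} {s : ℕ}
    {x : MvPolynomial (Fin n) K ⧸ I} :
    x ∈ quotientDegreeLE I s ↔
      ∃ p : MvPolynomial (Fin n) K, p.totalDegree ≤ s ∧ Ideal.Quotient.mk I p = x := by
  simp [quotientDegreeLE, Submodule.mem_map, mem_restrictTotalDegree]

lemma mk_mem_quotientDegreeLE (I : Ideal (MvPolynomial (Fin n) K)) {s : ℕ}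
    {p : MvPolynomial (Fin n) K} (hp : p.totalDegree ≤ s) :
    Ideal.Quotient.mk I p ∈ quotientDegreeLE I s :=
  mem_quotientDegreeLE.mpr ⟨p, hp, rfl⟩

lemma hilbertFunction_mono (I : Ideal (MvPolynomial (Fin n) K)) : Monotone (hilbertFunction I) := by
  intro s t hst
  refine Submodule.finrank_mono fun x hx ↦ ?_
  obtain ⟨p, hp, rfl⟩ := mem_quotientDegreeLE.mp hx
  exact mk_mem_quotientDegreeLE I (hp.trans hst)

lemma map_factor_quotientDegreeLE {I J : Ideal (MvPolynomial (Fin n) K)} (h : I ≤ J) (s : ℕ) :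
    (quotientDegreeLE I s).map (Ideal.Quotient.factorₐ K h).toLinearMap = quotientDegreeLE J s := by
  ext x
  simp [Submodule.mem_map, mem_quotientDegreeLE]

lemma hilbertFunction_anti {I J : Ideal (MvPolynomial (Fin n) K)} (h : I ≤ J) (s : ℕ) :
    hilbertFunction J s ≤ hilbertFunction I s := by
  rw [hilbertFunction, ← map_factor_quotientDegreeLE h]
  exact Submodule.finrank_map_le _ _

lemma hilbertFunction_sup_span_add_le {P : Ideal (MvPolynomial (Fin n) K)} [P.IsPrime]
    {f : MvPolynomial (Fin n) K} (hf : f ∉ P) {b t : ℕ} (hb : f.totalDegree ≤ b) (hbt : b ≤ t) :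
    hilbertFunction (P ⊔ Ideal.span {f}) t + hilbertFunction P (t - b) ≤ hilbertFunction P t := by
  have hPJ : P ≤ P ⊔ Ideal.span {f} := le_sup_left
  let π := (Ideal.Quotient.factorₐ K hPJ).toLinearMap
  let φ := π.domRestrict (quotientDegreeLE P t)
  have hrange : LinearMap.range φ = quotientDegreeLE (P ⊔ Ideal.span {f}) t := by
    rw [← map_factor_quotientDegreeLE hPJ, LinearMap.range_domRestrict]
  have hmem : ∀ x ∈ quotientDegreeLE P (t - b),
      Ideal.Quotient.mk P f * x ∈ quotientDegreeLE P t := by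
    intro x hx
    obtain ⟨p, hp, rfl⟩ := mem_quotientDegreeLE.mp hx
    rw [← map_mul]
    refine mk_mem_quotientDegreeLE P ((totalDegree_mul _ _).trans ?_)
    omega
  let m : quotientDegreeLE P (t - b) →ₗ[K] quotientDegreeLE P t :=
    (LinearMap.mulLeft K (Ideal.Quotient.mk P f)).restrict hmem
  have hker : ∀ x, m x ∈ LinearMap.ker φ := by
    intro x
    rw [LinearMap.mem_ker]
    change Ideal.Quotient.factor hPJ (Ideal.Quotient.mk P f * x.1) = 0
    rw [map_mul, Ideal.Quotient.factor_mk, Ideal.Quotient.eq_zero_iff_mem.mpr, zero_mul]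
    exact Ideal.mem_sup_right (Ideal.mem_span_singleton_self f)
  have hinj : Function.Injective (m.codRestrict _ hker) := by
    intro x y hxy
    have h : Ideal.Quotient.mk P f * x.1 = Ideal.Quotient.mk P f * y.1 :=
      congrArg (fun z ↦ z.1.1) hxy
    exact Subtype.ext (mul_left_cancel₀ (by rwa [Ne, Ideal.Quotient.eq_zero_iff_mem]) h)
  have h1 := LinearMap.finrank_range_add_finrank_ker φ
  rw [hrange] at h1
  have h2 := LinearMap.finrank_le_finrank_of_injective hinj
  unfold hilbertFunction
  omega

lemma sum_hilbertFunction_sup_span_le {P : Ideal (MvPolynomial (Fin n) K)} [P.IsPrime]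
    {f : MvPolynomial (Fin n) K} (hf : f ∉ P) {b : ℕ} (hb : f.totalDegree ≤ b) (T : ℕ) :
    ∑ t ∈ Finset.range T, hilbertFunction (P ⊔ Ideal.span {f}) t ≤ b * hilbertFunction P T := by
  have h1 : ∑ t ∈ Finset.range T, hilbertFunction (P ⊔ Ideal.span {f}) t +
      ∑ t ∈ Finset.range (T - b), hilbertFunction P t ≤
        ∑ t ∈ Finset.range T, hilbertFunction P t := by
    induction T with
    | zero => simp
    | succ T ih =>
      rw [Finset.sum_range_succ, Finset.sum_range_succ (hilbertFunction P) T]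
      rcases le_or_gt b T with h | h
      · rw [Nat.sub_add_comm h, Finset.sum_range_succ]
        have := hilbertFunction_sup_span_add_le hf hb h
        omega
      · have := hilbertFunction_anti (le_sup_left : P ≤ P ⊔ Ideal.span {f}) T
        rw [show T - b = 0 by omega] at ih
        rw [show T + 1 - b = 0 by omega]
        omega
  have h2 : ∑ t ∈ Finset.range T, hilbertFunction P t ≤
      ∑ t ∈ Finset.range (T - b), hilbertFunction P t + b * hilbertFunction P T := by
    clear h1 hb
    induction b with
    | zero => simp
    | succ b ih =>
      refine ih.trans ?_
      rw [add_one_mul, ← Nat.sub_sub]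
      rcases Nat.eq_zero_or_eq_succ_pred (T - b) with h | h
      · rw [h]
        simp
      · have h3 := hilbertFunction_mono P (show (T - b).pred ≤ T by omega)
        rw [h, Finset.sum_range_succ, Nat.succ_sub_one]
        omega
  omega

lemma HilbertGrowth.of_sup_span {P : Ideal (MvPolynomial (Fin n) K)} [P.IsPrime]
    {f : MvPolynomial (Fin n) K} (hf : f ∉ P) {b : ℕ} (hb : f.totalDegree ≤ b) {A B r : ℕ}
    (h : HilbertGrowth (P ⊔ Ideal.span {f}) A B r) : HilbertGrowth P A (b * B) (r + 1) := by
  obtain ⟨e, he⟩ := h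
  refine ⟨e + 1, fun s ↦ ?_⟩
  calc A * (s + (r + 1)).choose (r + 1)
      = ∑ i ∈ Finset.range (s + 1), A * (i + r).choose r := by
        rw [← Finset.mul_sum, Nat.sum_range_add_choose, add_assoc]
    _ ≤ ∑ i ∈ Finset.range (s + 1), B * hilbertFunction (P ⊔ Ideal.span {f}) (e + i) :=
        Finset.sum_le_sum fun i _ ↦ add_comm e i ▸ he i
    _ ≤ B * ∑ t ∈ Finset.range (e + (s + 1)), hilbertFunction (P ⊔ Ideal.span {f}) t := by
        rw [← Finset.mul_sum, Finset.sum_range_add _ e (s + 1)]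
        gcongr
        exact Nat.le_add_left _ _
    _ ≤ B * (b * hilbertFunction P (e + (s + 1))) := by
        gcongr
        exact sum_hilbertFunction_sup_span_le hf hb _
    _ = b * B * hilbertFunction P (s + (e + 1)) := by
        rw [show e + (s + 1) = s + (e + 1) by ring]
        ring

lemma HilbertGrowth.exists_forall_ge {I : Ideal (MvPolynomial (Fin n) K)} {A B r : ℕ}
    (h : HilbertGrowth I A B r) :
    ∃ e, ∀ e' ≥ e, ∀ s, A * (s + r).choose r ≤ B * hilbertFunction I (s + e') := by
  obtain ⟨e, he⟩ := h
  refine ⟨e, fun e' h' s ↦ (he s).trans ?_⟩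
  gcongr
  exact hilbertFunction_mono I (by omega)

lemma exists_forall_hilbertGrowth {ι : Type*} [Fintype ι]
    {I : ι → Ideal (MvPolynomial (Fin n) K)} {A : ι → ℕ} {B r : ℕ}
    (h : ∀ i, HilbertGrowth (I i) (A i) B r) :
    ∃ e, ∀ i s, A i * (s + r).choose r ≤ B * hilbertFunction (I i) (s + e) := by
  choose e he using fun i ↦ (h i).exists_forall_ge
  exact ⟨∑ i, e i, fun i s ↦ he i _ (Finset.single_le_sum (fun _ _ ↦ Nat.zero_le _)
    (Finset.mem_univ i)) s⟩

lemma HilbertGrowth.sum {ι : Type*} [Fintype ι] {I : Ideal (MvPolynomial (Fin n) K)}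
    {A : ι → ℕ} {B r : ℕ} (h : ∀ i, HilbertGrowth I (A i) B r) :
    HilbertGrowth I (∑ i, A i) (Fintype.card ι * B) r := by
  obtain ⟨e, he⟩ := exists_forall_hilbertGrowth h
  refine ⟨e, fun s ↦ ?_⟩
  rw [Finset.sum_mul]
  refine (Finset.sum_le_sum fun i _ ↦ he i s).trans ?_
  simp [mul_assoc]

lemma HilbertGrowth.mono {I : Ideal (MvPolynomial (Fin n) K)} {A A' B r : ℕ}
    (h : HilbertGrowth I A B r) (hA : A' ≤ A) : HilbertGrowth I A' B r := by
  obtain ⟨e, he⟩ := h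
  exact ⟨e, fun s ↦ (Nat.mul_le_mul_right _ hA).trans (he s)⟩

/-- The Hilbert functions of pairwise incomparable primes add up, up to a shift. -/
lemma exists_sum_hilbertFunction_le {ι : Type*} [Fintype ι] {J : Ideal (MvPolynomial (Fin n) K)}
    {Q : ι → Ideal (MvPolynomial (Fin n) K)} (hQ : ∀ i, (Q i).IsPrime) (hJ : ∀ i, J ≤ Q i)
    (hne : ∀ i j, Q i ≤ Q j → i = j) :
    ∃ e, ∀ s, ∑ i, hilbertFunction (Q i) s ≤ hilbertFunction J (s + e) := by
  classical
  have hf : ∀ i, ∃ f, (∀ j ≠ i, f ∈ Q j) ∧ f ∉ Q i := by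
    intro i
    by_contra! hcon
    have hle : (Finset.univ.erase i).inf Q ≤ Q i := fun f hf ↦ by
      refine hcon f fun j hj ↦ ?_
      exact (Finset.inf_le (f := Q) (Finset.mem_erase.mpr ⟨hj, Finset.mem_univ j⟩)) hf
    obtain ⟨j, hj, hji⟩ := (Ideal.IsPrime.inf_le' (hQ i)).mp hle
    exact (Finset.mem_erase.mp hj).1 (hne j i hji)
  choose f hf hfi using hf
  refine ⟨∑ i, (f i).totalDegree, fun s ↦ ?_⟩
  let Φ : (∀ i, quotientDegreeLE (Q i) s) →ₗ[K] (∀ i, MvPolynomial (Fin n) K ⧸ Q i) :=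
    LinearMap.pi fun i ↦ LinearMap.mulLeft K (Ideal.Quotient.mk (Q i) (f i)) ∘ₗ
      (quotientDegreeLE (Q i) s).subtype ∘ₗ LinearMap.proj i
  let Ψ : (MvPolynomial (Fin n) K ⧸ J) →ₗ[K] (∀ i, MvPolynomial (Fin n) K ⧸ Q i) :=
    LinearMap.pi fun i ↦ (Ideal.Quotient.factorₐ K (hJ i)).toLinearMap
  have hΦ : Function.Injective Φ := by
    intro x y hxy
    funext i
    have h : Ideal.Quotient.mk (Q i) (f i) * (x i).1 = Ideal.Quotient.mk (Q i) (f i) * (y i).1 :=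
      congrFun hxy i
    exact Subtype.ext (mul_left_cancel₀ (by rw [Ne, Ideal.Quotient.eq_zero_iff_mem]; exact hfi i) h)
  have hrange : LinearMap.range Φ ≤
      (quotientDegreeLE J (s + ∑ i, (f i).totalDegree)).map Ψ := by
    rintro _ ⟨x, rfl⟩
    choose p hp hpx using fun i ↦ mem_quotientDegreeLE.mp (x i).2
    refine ⟨Ideal.Quotient.mk J (∑ i, f i * p i), mk_mem_quotientDegreeLE J ?_, ?_⟩
    · refine totalDegree_finsetSum_le fun i _ ↦ (totalDegree_mul _ _).trans ?_
      rw [add_comm]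
      exact add_le_add (hp i) (Finset.single_le_sum (f := fun i ↦ (f i).totalDegree)
        (fun _ _ ↦ Nat.zero_le _) (Finset.mem_univ i))
    · funext j
      change Ideal.Quotient.factor (hJ j) (Ideal.Quotient.mk J (∑ i, f i * p i)) =
        Ideal.Quotient.mk (Q j) (f j) * (x j).1
      rw [Ideal.Quotient.factor_mk, map_sum, Finset.sum_eq_single j, map_mul, hpx]
      · intro i _ hij
        rw [map_mul, Ideal.Quotient.eq_zero_iff_mem.mpr (hf i j hij.symm), zero_mul]
      · simp
  have hfree : ∀ i, Module.Free K (quotientDegreeLE (Q i) s) :=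
    fun i ↦ Module.Free.of_divisionRing K _
  calc ∑ i, hilbertFunction (Q i) s
      = Module.finrank K (∀ i, quotientDegreeLE (Q i) s) :=
        (Module.finrank_pi_fintype K).symm
    _ = Module.finrank K (LinearMap.range Φ) := (LinearMap.finrank_range_of_inj hΦ).symm
    _ ≤ Module.finrank K ((quotientDegreeLE J (s + ∑ i, (f i).totalDegree)).map Ψ) :=
        Submodule.finrank_mono hrange
    _ ≤ _ := Submodule.finrank_map_le _ _

lemma hilbertFunction_le_choose (I : Ideal (MvPolynomial (Fin n) K)) (s : ℕ) :
    hilbertFunction I s ≤ (s + n).choose n := by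
  refine (Submodule.finrank_map_le _ _).trans ?_
  let e : {m : Fin n →₀ ℕ | (m.sum fun _ e ↦ e) ≤ s} →
      (Finset.univ : Finset (Fin (n + 1))).finsuppAntidiag s := fun m ↦
    ⟨Finsupp.cons (s - m.1.sum fun _ e ↦ e) m.1, by
      have := m.2
      simp only [Set.mem_ofPred_eq] at this
      simp only [Finset.mem_finsuppAntidiag, Finset.subset_univ, and_true, Fin.sum_univ_succ,
        Finsupp.cons_zero, Finsupp.cons_succ]
      rw [Finsupp.sum_fintype _ _ (by simp)] at this ⊢
      omega⟩
  have he : Function.Injective e := by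
    intro a b hab
    have h := congrArg (fun z ↦ Finsupp.tail z.1) hab
    simp only [e, Finsupp.tail_cons] at h
    exact Subtype.ext h
  have := Finite.of_injective e he
  rw [restrictTotalDegree, Module.finrank_eq_nat_card_basis (basisRestrictSupport K _)]
  refine (Nat.card_le_card_of_injective e he).trans ?_
  rw [Nat.card_eq_fintype_card, Fintype.card_coe, Finset.card_finsuppAntidiag_nat_eq_choose,
    Finset.card_univ, Fintype.card_fin, Nat.choose_symm_of_eq_add (b := n) (by omega),
    show n + 1 + s - 1 = s + n by omega]

end HilbertFunction

section RationalPoints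

variable {K : Type*} [Field K] {n : ℕ}

lemma mem_rationalPoints_sup_span {I : Ideal (MvPolynomial (Fin n) K)}
    {f : MvPolynomial (Fin n) K} {x : Fin n → K} :
    x ∈ rationalPoints (I ⊔ Ideal.span {f}) ↔ x ∈ rationalPoints I ∧ eval x f = 0 := by
  have h (J : Ideal (MvPolynomial (Fin n) K)) : x ∈ rationalPoints J ↔ J ≤ RingHom.ker (eval x) :=
    Iff.rfl
  rw [h, h, sup_le_iff, Ideal.span_singleton_le_iff_mem, RingHom.mem_ker]

lemma exists_minimalPrimes_mem_rationalPoints {J : Ideal (MvPolynomial (Fin n) K)} {x : Fin n → K}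
    (hx : x ∈ rationalPoints J) : ∃ Q ∈ J.minimalPrimes, x ∈ rationalPoints Q := by
  have hxJ : J ≤ RingHom.ker (eval x) := hx
  have := RingHom.ker_isPrime (eval x)
  obtain ⟨Q, hQ, hQx⟩ := Ideal.exists_minimalPrimes_le hxJ
  exact ⟨Q, hQ, hQx⟩

/-- A prime containing `Xᵢ - cᵢ` for some `cᵢ`, for all `i`, has zero-dimensional quotient. -/
lemma ringKrullDim_quotient_le_zero {P : Ideal (MvPolynomial (Fin n) K)} [P.IsPrime]
    {c : Fin n → K} (h : ∀ i, X i - C (c i) ∈ P) :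
    ringKrullDim (MvPolynomial (Fin n) K ⧸ P) ≤ 0 := by
  have hsurj : Function.Surjective (algebraMap K (MvPolynomial (Fin n) K ⧸ P)) := by
    have hmk : ∀ p : MvPolynomial (Fin n) K,
        Ideal.Quotient.mk P p = algebraMap K (MvPolynomial (Fin n) K ⧸ P) (eval c p) := by
      intro p
      have : Ideal.Quotient.mkₐ K P = (Algebra.ofId K _).comp (aeval c) := by
        refine algHom_ext fun i ↦ ?_
        simpa [Algebra.ofId_apply] using! Ideal.Quotient.eq.mpr (h i)
      exact DFunLike.congr_fun this p
    intro y
    obtain ⟨p, rfl⟩ := Ideal.Quotient.mk_surjective y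
    exact ⟨_, (hmk p).symm⟩
  exact (ringKrullDim_le_of_surjective _ hsurj).trans (by simp)

variable [Fintype K]

lemma hilbertGrowth_zero (I : Ideal (MvPolynomial (Fin n) K)) :
    HilbertGrowth I (rationalPoints I).ncard 1 0 := by
  classical
  have := Fintype.ofFinite (rationalPoints I)
  let e := ∑ x : rationalPoints I, (indicator x.1).totalDegree
  let ev : MvPolynomial (Fin n) K ⧸ I →ₐ[K] (rationalPoints I → K) :=
    Ideal.Quotient.liftₐ I (AlgHom.pi fun x ↦ aeval x.1) fun p hp ↦ by
      funext x
      simpa [aeval_eq_eval] using x.2 p hp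
  have htop : (quotientDegreeLE I e).map ev.toLinearMap = ⊤ := by
    refine eq_top_iff.mpr fun v _ ↦ ?_
    refine ⟨Ideal.Quotient.mk I (∑ x : rationalPoints I, v x • indicator x.1),
      mk_mem_quotientDegreeLE I ?_, ?_⟩
    · refine totalDegree_finsetSum_le fun x _ ↦ (totalDegree_smul_le _ _).trans ?_
      exact Finset.single_le_sum (f := fun x : rationalPoints I ↦ (indicator x.1).totalDegree)
        (fun _ _ ↦ Nat.zero_le _) (Finset.mem_univ x)
    · funext y
      change aeval y.1 (∑ x : rationalPoints I, v x • indicator x.1) = v y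
      rw [map_sum, Finset.sum_eq_single y]
      · simp [aeval_eq_eval, eval_indicator_apply_eq_one]
      · intro x _ hxy
        simp [aeval_eq_eval,
          eval_indicator_apply_eq_zero y.1 x.1 fun h ↦ hxy (Subtype.ext h.symm)]
      · simp
  have hle : (rationalPoints I).ncard ≤ hilbertFunction I e := calc
    (rationalPoints I).ncard = Module.finrank K (rationalPoints I → K) := by
      rw [Module.finrank_fintype_fun_eq_card, ← Nat.card_eq_fintype_card, Nat.card_coe_set_eq]
    _ = Module.finrank K ((quotientDegreeLE I e).map ev.toLinearMap) := by rw [htop, finrank_top]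
    _ ≤ _ := Submodule.finrank_map_le _ _
  refine ⟨e, fun s ↦ ?_⟩
  simpa using hle.trans (hilbertFunction_mono I (Nat.le_add_left e s))

/-- Growth estimates for the Hilbert functions of the components of a variety add up. -/
lemma HilbertGrowth.of_minimalPrimes {J : Ideal (MvPolynomial (Fin n) K)} {B r : ℕ}
    (h : ∀ Q ∈ J.minimalPrimes, HilbertGrowth Q (rationalPoints Q).ncard B r) :
    HilbertGrowth J (rationalPoints J).ncard B r := by
  classical
  have := (Ideal.finite_minimalPrimes_of_isNoetherianRing _ J).fintype
  obtain ⟨e, he⟩ := exists_forall_hilbertGrowth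
    (I := fun Q : J.minimalPrimes ↦ Q.1) fun Q ↦ h Q.1 Q.2
  obtain ⟨e', he'⟩ := exists_sum_hilbertFunction_le (J := J)
    (Q := fun Q : J.minimalPrimes ↦ Q.1) (fun Q ↦ Q.2.1.1) (fun Q ↦ Q.2.1.2)
    fun Q Q' hle ↦ Subtype.ext (hle.antisymm (Q'.2.2 Q.2.1 hle))
  have hcard : (rationalPoints J).ncard ≤ ∑ Q : J.minimalPrimes, (rationalPoints Q.1).ncard := by
    refine (Set.ncard_le_ncard (t := ⋃ Q ∈ (Finset.univ : Finset J.minimalPrimes),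
      rationalPoints Q.1) (fun x hx ↦ ?_) (Set.toFinite _)).trans
        (Finset.set_ncard_biUnion_le _ _)
    obtain ⟨Q, hQ, hxQ⟩ := exists_minimalPrimes_mem_rationalPoints hx
    simp only [Set.mem_iUnion]
    exact ⟨⟨Q, hQ⟩, Finset.mem_univ _, hxQ⟩
  refine ⟨e + e', fun s ↦ ?_⟩
  calc (rationalPoints J).ncard * (s + r).choose r
      ≤ (∑ Q : J.minimalPrimes, (rationalPoints Q.1).ncard) * (s + r).choose r := by gcongr
    _ ≤ ∑ Q : J.minimalPrimes, B * hilbertFunction Q.1 (s + e) := by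
        rw [Finset.sum_mul]
        exact Finset.sum_le_sum fun Q _ ↦ he Q s
    _ ≤ B * hilbertFunction J (s + (e + e')) := by
        rw [← Finset.mul_sum, ← add_assoc]
        gcongr
        exact he' _

/-- A lower bound for the Hilbert function of an affine variety of dimension at least `r` in
terms of its number of rational points. -/
theorem hilbertGrowth_of_le_ringKrullDim (r : ℕ) {P : Ideal (MvPolynomial (Fin n) K)} [P.IsPrime]
    (h : (r : WithBot ℕ∞) ≤ ringKrullDim (MvPolynomial (Fin n) K ⧸ P)) :
    HilbertGrowth P (rationalPoints P).ncard (Fintype.card K ^ r) r := by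
  induction r generalizing P with
  | zero => simpa using hilbertGrowth_zero P
  | succ r ih =>
    obtain ⟨i, hi⟩ : ∃ i, ∀ c : K, X i - C c ∉ P := by
      by_contra! hcon
      choose c hc using hcon
      have := h.trans (ringKrullDim_quotient_le_zero hc)
      norm_cast at this
    have hsup : ∀ c : K, HilbertGrowth (P ⊔ Ideal.span {X i - C c})
        (rationalPoints (P ⊔ Ideal.span {X i - C c})).ncard (Fintype.card K ^ r) r := by
      refine fun c ↦ .of_minimalPrimes fun Q hQ ↦ ?_
      have := hQ.1.1
      refine ih ?_
      have h1 := h.trans (ringKrullDim_quotient_le_add_one hQ)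
      push_cast at h1
      exact ENat.WithBot.add_le_add_one_right_iff.mp h1
    have hdeg : ∀ c : K, (X i - C c : MvPolynomial (Fin n) K).totalDegree ≤ 1 := fun c ↦
      (totalDegree_sub_C_le _ _).trans (totalDegree_X i).le
    have hsum := HilbertGrowth.sum fun c ↦ (hsup c).of_sup_span (hi c) (hdeg c)
    rw [one_mul, ← pow_succ'] at hsum
    refine hsum.mono ?_
    refine (Set.ncard_le_ncard (t := ⋃ c ∈ (Finset.univ : Finset K),
      rationalPoints (P ⊔ Ideal.span {X i - C c})) (fun x hx ↦ ?_) (Set.toFinite _)).trans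
        (Finset.set_ncard_biUnion_le _ _)
    simp only [Set.mem_iUnion]
    exact ⟨x i, Finset.mem_univ _, mem_rationalPoints_sup_span.mpr ⟨hx, by simp⟩⟩

end RationalPoints

section Derivatives

variable {K σ : Type*} [Field K]

lemma totalDegree_pderiv_le (i : σ) (p : MvPolynomial σ K) :
    (pderiv i p).totalDegree ≤ p.totalDegree - 1 := by
  refine Finset.sup_le fun m hm ↦ ?_
  rw [mem_support_iff, coeff_pderiv] at hm
  have h := le_totalDegree (mem_support_iff.mpr (left_ne_zero_of_mul hm))
  change (m + Finsupp.single i 1).degree ≤ _ at h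
  rw [map_add, Finsupp.degree_single] at h
  change m.degree ≤ _
  omega

/-- Over a perfect field of positive characteristic, an irreducible polynomial has a nonzero
partial derivative. -/
lemma exists_pderiv_ne_zero (ℓ : ℕ) [hℓ : Fact ℓ.Prime] [CharP K ℓ] [PerfectRing K ℓ]
    {p : MvPolynomial σ K} (hp : Irreducible p) : ∃ i, pderiv i p ≠ 0 := by
  by_contra! hcon
  have hdvd : ∀ m ∈ p.support, ∀ i, ℓ ∣ m i := by
    intro m hm i
    rw [← CharP.cast_eq_zero_iff K ℓ]
    by_contra hmi
    have hpos : 1 ≤ m i := Nat.one_le_iff_ne_zero.mpr fun h ↦ hmi (by simp [h])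
    have hle : Finsupp.single i 1 ≤ m := by simpa using hpos
    have h := coeff_pderiv (i := i) p (m - Finsupp.single i 1)
    rw [hcon i, coeff_zero, tsub_add_cancel_of_le hle, Finsupp.tsub_apply,
      Finsupp.single_eq_same, Nat.cast_sub hpos, Nat.cast_one, sub_add_cancel] at h
    exact mul_ne_zero (mem_support_iff.mp hm) hmi h.symm
  have hpow : p = (∑ m ∈ p.support, monomial (m.mapRange (· / ℓ) (Nat.zero_div ℓ))
      ((frobeniusEquiv K ℓ).symm (coeff m p))) ^ ℓ := by
    rw [sum_pow_char]
    conv_lhs => rw [p.as_sum]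
    refine Finset.sum_congr rfl fun m hm ↦ ?_
    rw [monomial_pow, frobeniusEquiv_symm_pow_p]
    have hm' : ℓ • m.mapRange (· / ℓ) (Nat.zero_div ℓ) = m := by
      ext i
      simp [Nat.mul_div_cancel' (hdvd m hm i)]
    rw [hm']
  exact not_irreducible_pow hℓ.out.ne_one (hpow ▸ hp)

lemma isLocalHom_map_algebraMap {L : Type*} [Field L] [Algebra K L] :
    IsLocalHom (MvPolynomial.map (σ := σ) (algebraMap K L)) := by
  refine ⟨fun p hp ↦ ?_⟩
  rw [isUnit_iff_totalDegree_of_isReduced] at hp ⊢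
  rw [coeff_map, totalDegree, support_map_of_injective _ (algebraMap K L).injective] at hp
  exact ⟨isUnit_of_map_unit _ _ hp.1, hp.2⟩

end Derivatives

/-- A comparison of leading terms: binomial coefficients grow like powers. -/
lemma le_of_forall_mul_choose_le {N D e n : ℕ}
    (h : ∀ s, N * (s + n).choose n ≤ D * (s + e + n).choose n) : N ≤ D := by
  have hpow : ∀ s : ℕ, N * (s + 1) ^ n ≤ D * (s + e + n) ^ n := fun s ↦ calc
    N * (s + 1) ^ n ≤ N * (s + n).descFactorial n := by
      gcongr
      simpa [show s + n + 1 - n = s + 1 by omega] using Nat.pow_sub_le_descFactorial (s + n) n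
    _ = n.factorial * (N * (s + n).choose n) := by
      rw [Nat.descFactorial_eq_factorial_mul_choose]
      ring
    _ ≤ n.factorial * (D * (s + e + n).choose n) := Nat.mul_le_mul_left _ (h s)
    _ = D * (s + e + n).descFactorial n := by
      rw [Nat.descFactorial_eq_factorial_mul_choose]
      ring
    _ ≤ D * (s + e + n) ^ n := by
      gcongr
      exact Nat.descFactorial_le_pow _ _
  have hlim : Filter.Tendsto (fun s : ℕ ↦ (D : ℝ) * (1 + (e + n - 1) * (1 / ((s : ℝ) + 1))) ^ n)
      Filter.atTop (nhds (D * (1 + (e + n - 1) * 0) ^ n)) :=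
    (((tendsto_one_div_add_atTop_nhds_zero_nat.const_mul _).const_add _).pow n).const_mul _
  rw [mul_zero, add_zero, one_pow, mul_one] at hlim
  have hle : (N : ℝ) ≤ D := by
    refine ge_of_tendsto' hlim fun s ↦ ?_
    have h1 : (N : ℝ) * (s + 1) ^ n ≤ D * (s + e + n) ^ n := mod_cast hpow s
    have hs : (0 : ℝ) < s + 1 := by positivity
    have h2 : (1 + ((e : ℝ) + n - 1) * (1 / ((s : ℝ) + 1))) = (s + e + n) / (s + 1) := by
      field_simp
      ring
    rwa [h2, div_pow, mul_div_assoc', le_div_iff₀ (by positivity)]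
  exact_mod_cast hle

/-- The number of singular `𝔽_q`-zeros of an absolutely irreducible polynomial `G` of
degree `d ≥ 1` in `n ≥ 2` variables over `𝔽_q` is at most `d(d-1) q^{n-2}`. -/
theorem singular_zeros_le
    {K : Type*} [Field K] [Fintype K] {n : ℕ} (hn : 2 ≤ n)
    {d : ℕ} (hd : 1 ≤ d)
    (G : MvPolynomial (Fin n) K) (hGdeg : G.totalDegree = d)
    (hGirr : Irreducible (MvPolynomial.map (algebraMap K (AlgebraicClosure K)) G)) :
    Set.ncard {x : Fin n → K |
        eval x G = 0 ∧ ∀ i : Fin n, eval x (pderiv i G) = 0} ≤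
      d * (d - 1) * Fintype.card K ^ (n - 2) := by
  have hlocal := isLocalHom_map_algebraMap (σ := Fin n) (K := K) (L := AlgebraicClosure K)
  have hG : Irreducible G := hGirr.of_map
  obtain ⟨ℓ, hchar⟩ := CharP.exists K
  have hℓ : Fact ℓ.Prime := ⟨CharP.char_is_prime K ℓ⟩
  obtain ⟨i, hi⟩ := exists_pderiv_ne_zero ℓ hG
  have hprime : (⊥ ⊔ Ideal.span {G}).IsPrime := by
    rw [bot_sup_eq, Ideal.span_singleton_prime hG.ne_zero]
    exact hG.prime
  have hbot : (⊥ : Ideal (MvPolynomial (Fin n) K)).IsPrime := Ideal.isPrime_bot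
  have hGbot : G ∉ (⊥ : Ideal (MvPolynomial (Fin n) K)) := hG.ne_zero
  have hiG : pderiv i G ∉ ⊥ ⊔ Ideal.span {G} := by
    rw [bot_sup_eq, Ideal.mem_span_singleton]
    intro hdvd
    have h1 := totalDegree_le_of_dvd_of_isDomain hdvd hi
    have h2 := totalDegree_pderiv_le i G
    omega
  obtain ⟨r, rfl⟩ := Nat.exists_eq_add_of_le' hn
  have hdim : ((r + 1 : ℕ) : WithBot ℕ∞) ≤
      ringKrullDim (MvPolynomial (Fin (r + 2)) K ⧸ ⊥ ⊔ Ideal.span {G}) := by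
    have h := ringKrullDim_quotient_le_add_one (P := ⊥) (f := G)
      (by rw [Ideal.minimalPrimes_eq_subsingleton_self]; exact Set.mem_singleton _)
    rw [ringKrullDim_eq_of_ringEquiv (RingEquiv.quotientBot _),
      MvPolynomial.ringKrullDim_of_isNoetherianRing, ringKrullDim_eq_zero_of_field, zero_add,
      Nat.card_eq_fintype_card, Fintype.card_fin, Nat.cast_add r 2] at h
    rw [← ENat.WithBot.add_le_add_one_right_iff]
    exact_mod_cast h
  have hgrowth : HilbertGrowth (⊥ ⊔ Ideal.span {G} ⊔ Ideal.span {pderiv i G})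
      (rationalPoints (⊥ ⊔ Ideal.span {G} ⊔ Ideal.span {pderiv i G})).ncard
      (Fintype.card K ^ r) r := by
    refine .of_minimalPrimes fun Q hQ ↦ ?_
    have := hQ.1.1
    have h := hdim.trans (ringKrullDim_quotient_le_add_one hQ)
    push_cast at h
    exact hilbertGrowth_of_le_ringKrullDim r (ENat.WithBot.add_le_add_one_right_iff.mp h)
  have hb : (pderiv i G).totalDegree ≤ d - 1 := hGdeg ▸ totalDegree_pderiv_le i G
  obtain ⟨e, he⟩ := (hgrowth.of_sup_span hiG hb).of_sup_span hGbot hGdeg.le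
  have hle := le_of_forall_mul_choose_le fun s ↦
    (he s).trans (Nat.mul_le_mul_left _ (hilbertFunction_le_choose ⊥ (s + e)))
  rw [← mul_assoc] at hle
  refine (Set.ncard_le_ncard (fun x hx ↦ ?_) (Set.toFinite _)).trans hle
  rw [mem_rationalPoints_sup_span, mem_rationalPoints_sup_span]
  refine ⟨⟨fun p hp ↦ ?_, hx.1⟩, hx.2 i⟩
  rw [Ideal.mem_bot.mp hp, map_zero]
end
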